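/- Let u_ε be a sequence of solutions of (E_ε) and let K be a compact subset of Ω∖Z. Then there exist constants a, b > 0 such that for every r > 0 and every pair of points x_ε, z_ε with z_ε ∈ B_{εr}(x_ε) ⊆ K, one has |u_ε(x_ε) − u_ε(z_ε)| ≤ a r² + b. -/

import Mathlib

open MeasureTheory Real Filter Set Metric Topology

noncomputable section

/-- The Euclidean plane `ℝ²`. -/
abbrev Pl := EuclideanSpace ℝ (Fin 2)

/-- The unit lattice `ℤ² ⊆ ℝ²`; the flat 2-torus `Ω` is its quotient, which we model by
working with doubly periodic functions on the plane. -/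
def unitLattice : Set Pl :=
  {v | ∃ a b : ℤ, v = (a : ℝ) • EuclideanSpace.single 0 (1:ℝ) +
      (b : ℝ) • EuclideanSpace.single 1 (1:ℝ)}

/-- A fundamental domain for the torus `Ω` (of total area `|Ω| = 1`). -/
def fund : Set Pl := {x | x 0 ∈ Ico (0:ℝ) 1 ∧ x 1 ∈ Ico (0:ℝ) 1}

/-- A doubly periodic function on the plane, i.e. a function on the torus `Ω`. -/
def Periodic2 (u : Pl → ℝ) : Prop := ∀ x : Pl, ∀ v ∈ unitLattice, u (x + v) = u x

/-- Partial derivative in the `i`-th coordinate direction. -/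
def pd (u : Pl → ℝ) (i : Fin 2) : Pl → ℝ :=
  fun x => lineDeriv ℝ u x (EuclideanSpace.single i (1:ℝ))

/-- The Laplacian `Δu`. -/
def lap (u : Pl → ℝ) (x : Pl) : ℝ := pd (pd u 0) 0 x + pd (pd u 1) 1 x

/-- `|∇u|²`. -/
def gradSq (u : Pl → ℝ) (x : Pl) : ℝ := (pd u 0 x) ^ 2 + (pd u 1 x) ^ 2

/-- The nonlinearity `f_τ(t) = e^t (1 − e^t) / (τ + e^t)³`. -/
def fτ (τ t : ℝ) : ℝ := exp t * (1 - exp t) / (τ + exp t) ^ 3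

/-- `f_τ'(t) = e^t (τ − 2(τ+1) e^t + e^{2t}) / (τ + e^t)⁴`. -/
def fτ' (τ t : ℝ) : ℝ := exp t * (τ - 2 * (τ + 1) * exp t + exp (2 * t)) / (τ + exp t) ^ 4

/-- The antiderivative `F_{2,τ}(t) = e^t ((1−τ) e^t + 2τ) / (2τ² (τ+e^t)²)` of `f_τ`. -/
def F2τ (τ t : ℝ) : ℝ := exp t * ((1 - τ) * exp t + 2 * τ) / (2 * τ ^ 2 * (τ + exp t) ^ 2)

/-- `u − 2a ln‖· − p‖` extends smoothly across `p`: this encodes the distributional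
equation `Δu = 4πa δ_p + (smooth)` near `p`. -/
def LogSing (u : Pl → ℝ) (p : Pl) (a : ℝ) : Prop :=
  ∃ r > 0, ∃ v : Pl → ℝ, ContDiffOn ℝ (⊤ : ℕ∞) v (ball p r) ∧
    ∀ x ∈ ball p r, x ≠ p → u x = 2 * a * Real.log ‖x - p‖ + v x

/-- The vortex data: distinct points `p_{j,1}` (`1 ≤ j ≤ d₁`), `p_{j,2}` (`1 ≤ j ≤ d₂`)
of the torus with multiplicities `m_{j,1} ≥ 0`, `m_{j,2} ≥ 0`. -/
structure VortexData where
  d₁ : ℕ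
  d₂ : ℕ
  p₁ : Fin d₁ → Pl
  p₂ : Fin d₂ → Pl
  m₁ : Fin d₁ → ℝ
  m₂ : Fin d₂ → ℝ
  m₁_nonneg : ∀ j, 0 ≤ m₁ j
  m₂_nonneg : ∀ j, 0 ≤ m₂ j
  distinct : ∀ i j : Fin d₁ ⊕ Fin d₂, i ≠ j → ∀ v ∈ unitLattice,
      Sum.elim p₁ p₂ i ≠ Sum.elim p₁ p₂ j + v

namespace VortexData
variable (V : VortexData)

/-- The set `Z₁` of vortex points `p_{j,1}` (viewed in the plane: all lattice translates). -/
def Z1 : Set Pl := {x | ∃ j v, v ∈ unitLattice ∧ x = V.p₁ j + v}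

/-- The set `Z₂` of vortex points `p_{j,2}` (viewed in the plane: all lattice translates). -/
def Z2 : Set Pl := {x | ∃ j v, v ∈ unitLattice ∧ x = V.p₂ j + v}

/-- The full vortex set `Z = Z₁ ∪ Z₂`. -/
def Z : Set Pl := V.Z1 ∪ V.Z2

/-- `N₁ = Σ_j m_{j,1}`. -/
def N1 : ℝ := ∑ j, V.m₁ j

/-- `N₂ = Σ_j m_{j,2}`. -/
def N2 : ℝ := ∑ j, V.m₂ j

end VortexData

/-- `u` is a solution of `(E_ε)`:
`Δu + ε⁻² f_τ(u) = 4π Σ_j m_{j,1} δ_{p_{j,1}} − 4π Σ_j m_{j,2} δ_{p_{j,2}}` on `Ω`,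
formulated classically: `u` is doubly periodic, smooth away from `Z`, solves the PDE
classically off `Z`, and has the prescribed logarithmic singularities at the vortices. -/
structure IsSolution (V : VortexData) (τ ε : ℝ) (u : Pl → ℝ) : Prop where
  periodic : Periodic2 u
  smooth : ContDiffOn ℝ (⊤ : ℕ∞) u (V.Z)ᶜ
  pde : ∀ x ∉ V.Z, lap u x + (ε ^ 2)⁻¹ * fτ τ (u x) = 0
  sing₁ : ∀ j, LogSing u (V.p₁ j) (V.m₁ j)
  sing₂ : ∀ j, LogSing u (V.p₂ j) (-(V.m₂ j))

/-- The quadratic form `∫_Ω |∇φ|² − ε⁻² f_τ'(u) φ²` of the linearized operator at `u`. -/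
def QuadForm (τ ε : ℝ) (u φ : Pl → ℝ) : ℝ :=
  ∫ x in fund, (gradSq φ x - (ε ^ 2)⁻¹ * fτ' τ (u x) * (φ x) ^ 2)

/-- `u` is a stable solution: the first eigenvalue `μ_ε` of the linearized operator is
nonnegative, i.e. the quadratic form is nonnegative on all (smooth, doubly periodic)
test functions. -/
def Stable (τ ε : ℝ) (u : Pl → ℝ) : Prop :=
  ∀ φ : Pl → ℝ, ContDiff ℝ (⊤ : ℕ∞) φ → Periodic2 φ → 0 ≤ QuadForm τ ε u φ

/-- `u` is strictly stable: the first eigenvalue `μ_ε` of the linearized operator is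
strictly positive. -/
def StrictlyStable (τ ε : ℝ) (u : Pl → ℝ) : Prop :=
  ∃ μ > 0, ∀ φ : Pl → ℝ, ContDiff ℝ (⊤ : ℕ∞) φ → Periodic2 φ →
    μ * (∫ x in fund, (φ x) ^ 2) ≤ QuadForm τ ε u φ

/-- Partial derivatives on `ℝ × ℝ`. -/
def dX (U : ℝ × ℝ → ℝ) (p : ℝ × ℝ) : ℝ := fderiv ℝ U p (1, 0)
def dY (U : ℝ × ℝ → ℝ) (p : ℝ × ℝ) : ℝ := fderiv ℝ U p (0, 1)

lemma dX_contDiffOn {U : ℝ × ℝ → ℝ} {W : Set (ℝ × ℝ)} (hW : IsOpen W)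
    (hU : ContDiffOn ℝ 2 U W) : ContDiffOn ℝ 1 (dX U) W :=
  (hU.fderiv_of_isOpen hW (by norm_num)).clm_apply contDiffOn_const

lemma dY_contDiffOn {U : ℝ × ℝ → ℝ} {W : Set (ℝ × ℝ)} (hW : IsOpen W)
    (hU : ContDiffOn ℝ 2 U W) : ContDiffOn ℝ 1 (dY U) W :=
  (hU.fderiv_of_isOpen hW (by norm_num)).clm_apply contDiffOn_const

lemma hasFDerivAt_of {U : ℝ × ℝ → ℝ} {W : Set (ℝ × ℝ)} (hW : IsOpen W)
    (hU : ContDiffOn ℝ 2 U W) {p : ℝ × ℝ} (hp : p ∈ W) : HasFDerivAt U (fderiv ℝ U p) p :=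
  (((hU.contDiffAt (hW.mem_nhds hp)).differentiableAt (by norm_num))).hasFDerivAt

lemma hasDerivAt_fst {U : ℝ × ℝ → ℝ} {W : Set (ℝ × ℝ)} (hW : IsOpen W)
    (hU : ContDiffOn ℝ 2 U W) {x y : ℝ} (hp : (x, y) ∈ W) :
    HasDerivAt (fun t => U (t, y)) (dX U (x, y)) x := by
  have h1 : HasDerivAt (fun t : ℝ => (t, y)) ((1 : ℝ), (0 : ℝ)) x :=
    (hasDerivAt_id x).prodMk (hasDerivAt_const x y)
  exact (hasFDerivAt_of hW hU hp).comp_hasDerivAt x h1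

lemma hasDerivAt_snd {U : ℝ × ℝ → ℝ} {W : Set (ℝ × ℝ)} (hW : IsOpen W)
    (hU : ContDiffOn ℝ 2 U W) {x y : ℝ} (hp : (x, y) ∈ W) :
    HasDerivAt (fun t => U (x, t)) (dY U (x, y)) y := by
  have h1 : HasDerivAt (fun t : ℝ => (x, t)) ((0 : ℝ), (1 : ℝ)) y :=
    (hasDerivAt_const y x).prodMk (hasDerivAt_id y)
  exact (hasFDerivAt_of hW hU hp).comp_hasDerivAt y h1

/-- one dimensional estimate -/
lemma oneD {h h' : ℝ → ℝ} {a b : ℝ}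
    (hd : ∀ t ∈ Icc a b, HasDerivAt h (h' t) t) (hc : ContinuousOn h' (Icc a b))
    {s t : ℝ} (hs : s ∈ Icc a b) (ht : t ∈ Icc a b) :
    |h s - h t| ≤ ∫ x in Icc a b, |h' x| := by
  have hsub : uIcc t s ⊆ Icc a b := uIcc_subset_Icc ht hs
  have e : ∫ x in t..s, h' x = h s - h t :=
    intervalIntegral.integral_eq_sub_of_hasDerivAt (fun x hx => hd x (hsub hx))
      ((hc.mono hsub).intervalIntegrable)
  rw [← e]
  calc |∫ x in t..s, h' x| ≤ ∫ x in uIoc t s, |h' x| :=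
        by simpa only [Real.norm_eq_abs] using
          intervalIntegral.norm_integral_le_integral_norm_uIoc (f := h') (a := t) (b := s) (μ := volume)
    _ ≤ _ := by
      apply setIntegral_mono_set
      · exact (hc.abs).integrableOn_Icc
      · exact ae_of_all _ fun x => abs_nonneg _
      · exact (uIoc_subset_uIcc.trans hsub).eventuallyLE

lemma poincare {U : ℝ × ℝ → ℝ} {W : Set (ℝ × ℝ)} (hW : IsOpen W)
    (hU : ContDiffOn ℝ 2 U W) {p : ℝ × ℝ} {l : ℝ} (hl : 0 < l) (hQ : closedBall p l ⊆ W) :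
    ∃ c, ∫ q in closedBall p l, (U q - c) ^ 2 ≤
      (∫ q in closedBall p l, (|dX U q| + |dY U q|)) ^ 2 := by
  obtain ⟨p1, p2⟩ := p
  rw [← closedBall_prod_same, Real.closedBall_eq_Icc, Real.closedBall_eq_Icc] at *
  set I := Icc (p1 - l) (p1 + l) with hI
  set J := Icc (p2 - l) (p2 + l) with hJ
  have hcX : ContinuousOn (fun q => |dX U q|) (I ×ˢ J) :=
    ((dX_contDiffOn hW hU).continuousOn.mono hQ).abs
  have hcY : ContinuousOn (fun q => |dY U q|) (I ×ˢ J) :=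
    ((dY_contDiffOn hW hU).continuousOn.mono hQ).abs
  have hcomp : IsCompact (I ×ˢ J) := isCompact_Icc.prod isCompact_Icc
  have hiX := hcX.integrableOn_compact hcomp (μ := volume)
  have hiY := hcY.integrableOn_compact hcomp (μ := volume)
  set A : ℝ → ℝ := fun y => ∫ x in I, |dX U (x, y)| with hA
  set B : ℝ → ℝ := fun x => ∫ y in J, |dY U (x, y)| with hB
  have hiX' := hiX
  have hiY' := hiY
  rw [IntegrableOn, Measure.volume_eq_prod, ← Measure.prod_restrict] at hiX' hiY'
  have hAint : IntegrableOn A J := hiX'.integral_prod_right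
  have hBint : IntegrableOn B I := hiY'.integral_prod_left
  have hAe : ∫ q in I ×ˢ J, |dX U q| = ∫ y in J, A y := by
    rw [Measure.volume_eq_prod, ← Measure.prod_restrict]
    exact integral_prod_symm _ hiX'
  have hBe : ∫ q in I ×ˢ J, |dY U q| = ∫ x in I, B x := by
    rw [Measure.volume_eq_prod, ← Measure.prod_restrict]
    exact integral_prod _ hiY'
  have hvI : volume.real I = 2 * l := by
    rw [hI, measureReal_def, Real.volume_Icc, ENNReal.toReal_ofReal (by linarith)]; ring
  have hvJ : volume.real J = 2 * l := by
    rw [hJ, measureReal_def, Real.volume_Icc, ENNReal.toReal_ofReal (by linarith)]; ring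
  have hI0 : volume I ≠ 0 := by
    intro h; rw [measureReal_def, h] at hvI; simp at hvI; linarith
  have hJ0 : volume J ≠ 0 := by
    intro h; rw [measureReal_def, h] at hvJ; simp at hvJ; linarith
  obtain ⟨y0, hy0, hy0'⟩ := exists_le_setAverage hJ0 isCompact_Icc.measure_ne_top hAint
  obtain ⟨x0, hx0, hx0'⟩ := exists_le_setAverage hI0 isCompact_Icc.measure_ne_top hBint
  rw [setAverage_eq, hvJ, smul_eq_mul] at hy0'
  rw [setAverage_eq, hvI, smul_eq_mul] at hx0'
  have hA0 : ∀ y, 0 ≤ A y := fun y => integral_nonneg fun x => abs_nonneg _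
  have hB0 : ∀ x, 0 ≤ B x := fun y => integral_nonneg fun x => abs_nonneg _
  have hAb : ∀ y ∈ J, ∀ x ∈ I, ∀ x' ∈ I, |U (x, y) - U (x', y)| ≤ A y := by
    intro y hy x hx x' hx'
    refine oneD (h := fun t => U (t, y)) (h' := fun t => dX U (t, y))
      (fun t ht => hasDerivAt_fst hW hU (hQ ⟨ht, hy⟩)) ?_ hx hx'
    exact ((dX_contDiffOn hW hU).continuousOn.mono hQ).comp (by fun_prop) fun t ht => ⟨ht, hy⟩
  have hBb : ∀ x ∈ I, ∀ y ∈ J, ∀ y' ∈ J, |U (x, y) - U (x, y')| ≤ B x := by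
    intro x hx y hy y' hy'
    refine oneD (h := fun t => U (x, t)) (h' := fun t => dY U (x, t))
      (fun t ht => hasDerivAt_snd hW hU (hQ ⟨hx, ht⟩)) ?_ hy hy'
    exact ((dY_contDiffOn hW hU).continuousOn.mono hQ).comp (by fun_prop) fun t ht => ⟨hx, ht⟩
  set a := ∫ y in J, A y with ha
  set b := ∫ x in I, B x with hb
  set α := (2 * l)⁻¹ * a
  set β := (2 * l)⁻¹ * b
  refine ⟨U (x0, y0), ?_⟩
  rw [integral_add hiX hiY, hAe, hBe]
  have hpt : ∀ q ∈ I ×ˢ J, (U q - U (x0, y0)) ^ 2 ≤ (B q.1 + α) * (A q.2 + β) := by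
    rintro ⟨x, y⟩ ⟨hx, hy⟩
    simp only at hx hy ⊢
    have h1 : |U (x, y) - U (x0, y0)| ≤ B x + α := by
      have := abs_sub_le (U (x, y)) (U (x, y0)) (U (x0, y0))
      have := hBb x hx y hy y0 hy0
      have := hAb y0 hy0 x hx x0 hx0
      linarith
    have h2 : |U (x, y) - U (x0, y0)| ≤ A y + β := by
      have := abs_sub_le (U (x, y)) (U (x0, y)) (U (x0, y0))
      have := hBb x0 hx0 y hy y0 hy0
      have := hAb y hy x hx x0 hx0
      linarith
    rw [← sq_abs, sq]
    exact mul_le_mul h1 h2 (abs_nonneg _) ((abs_nonneg _).trans h1)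
  have hBi : IntegrableOn (fun x => B x + α) I := hBint.add (by simp [hI])
  have hAi : IntegrableOn (fun x => A x + β) J := hAint.add (by simp [hJ])
  calc ∫ q in I ×ˢ J, (U q - U (x0, y0)) ^ 2
      ≤ ∫ q in I ×ˢ J, (B q.1 + α) * (A q.2 + β) := by
        apply setIntegral_mono_on _ _ hcomp.measurableSet hpt
        · exact (((hU.continuousOn.mono hQ).sub continuousOn_const).pow 2).integrableOn_compact hcomp
        · rw [IntegrableOn, Measure.volume_eq_prod, ← Measure.prod_restrict]
          exact Integrable.mul_prod hBi hAi
    _ = (∫ x in I, (B x + α)) * ∫ y in J, (A y + β) := by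
        rw [Measure.volume_eq_prod, setIntegral_prod_mul (fun x => B x + α) (fun y => A y + β)]
    _ = (b + 2 * l * α) * (a + 2 * l * β) := by
        rw [integral_add hBint (by simp [hI]), integral_add hAint (by simp [hJ])]
        simp only [setIntegral_const, hvI, hvJ, smul_eq_mul]
        rfl
    _ = (a + b) ^ 2 := by
        simp only [α, β]
        field_simp
        ring
    _ ≤ _ := le_refl _

def lapR (U : ℝ × ℝ → ℝ) (p : ℝ × ℝ) : ℝ := dX (dX U) p + dY (dY U) p

def bumpPhi (y : ℝ × ℝ) : ℝ := (max (1 - y.1 ^ 2 - y.2 ^ 2) 0) ^ 2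
def bumpphi (y : ℝ × ℝ) : ℝ := 4 * max (1 - y.1 ^ 2 - y.2 ^ 2) 0

lemma hasDerivAt_maxsq (s : ℝ) : HasDerivAt (fun s : ℝ => (max s 0) ^ 2) (2 * max s 0) s := by
  rcases lt_trichotomy s 0 with h | h | h
  · rw [max_eq_right h.le, mul_zero]
    refine (hasDerivAt_const s (0 : ℝ)).congr_of_eventuallyEq ?_
    filter_upwards [gt_mem_nhds h] with t ht
    simp [max_eq_right ht.le]
  · subst h
    rw [hasDerivAt_iff_isLittleO]
    have h1 : (fun x : ℝ => x ^ 2) =o[𝓝 0] fun x => x := by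
      simpa using Asymptotics.isLittleO_pow_pow (𝕜 := ℝ) (m := 1) (n := 2) (by norm_num)
    refine Asymptotics.IsBigO.trans_isLittleO ?_ (by simpa using h1)
    refine Asymptotics.IsBigO.of_bound 1 (Eventually.of_forall fun x => ?_)
    simp only [max_self, mul_zero, smul_zero, sub_zero, ne_eq, OfNat.ofNat_ne_zero,
      not_false_eq_true, zero_pow, norm_pow, Real.norm_eq_abs, one_mul]
    refine pow_le_pow_left₀ (abs_nonneg _) ?_ 2
    rcases le_total x 0 with h | h
    · rw [max_eq_right h, abs_zero]; exact abs_nonneg x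
    · rw [max_eq_left h]
  · rw [max_eq_left h.le]
    have := (hasDerivAt_id s).pow 2
    simp only [id, Nat.cast_ofNat, mul_one] at this
    have h2 : HasDerivAt (fun x : ℝ => x ^ 2) (2 * s) s := by
      simpa using hasDerivAt_pow 2 s
    refine h2.congr_of_eventuallyEq ?_
    filter_upwards [lt_mem_nhds h] with t ht
    simp [max_eq_left ht.le]

lemma hasFDerivAt_bumpPhi (y : ℝ × ℝ) : HasFDerivAt bumpPhi
    ((2 * max (1 - y.1 ^ 2 - y.2 ^ 2) 0) •
      (-(2 * y.1) • ContinuousLinearMap.fst ℝ ℝ ℝ - (2 * y.2) • ContinuousLinearMap.snd ℝ ℝ ℝ)) y := by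
  have h : HasFDerivAt (fun y : ℝ × ℝ => 1 - y.1 ^ 2 - y.2 ^ 2)
      (-(2 * y.1) • ContinuousLinearMap.fst ℝ ℝ ℝ - (2 * y.2) • ContinuousLinearMap.snd ℝ ℝ ℝ) y := by
    have h1 := (hasFDerivAt_fst (𝕜 := ℝ) (p := y)).pow 2
    have h2 := (hasFDerivAt_snd (𝕜 := ℝ) (p := y)).pow 2
    refine ((h1.const_sub 1).sub h2).congr_fderiv ?_
    ext <;> simp
  exact (hasDerivAt_maxsq _).comp_hasFDerivAt y h

lemma bumpPhi_cont : Continuous bumpPhi := by unfold bumpPhi; fun_prop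
lemma bumpphi_cont : Continuous bumpphi := by unfold bumpphi; fun_prop

lemma cb01 : closedBall (0 : ℝ × ℝ) 1 = Icc (-1, -1) (1, 1) := by
  rw [show (0 : ℝ × ℝ) = (0, 0) from rfl, ← closedBall_prod_same, Real.closedBall_eq_Icc, Icc_prod_eq]
  simp

lemma vol_cb (p : ℝ × ℝ) {l : ℝ} (hl : 0 ≤ l) : volume.real (closedBall p l) = 4 * l ^ 2 := by
  obtain ⟨p1, p2⟩ := p
  rw [← closedBall_prod_same, Real.closedBall_eq_Icc, Real.closedBall_eq_Icc, measureReal_def,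
    Measure.volume_eq_prod, Measure.prod_prod, Real.volume_Icc, Real.volume_Icc, ENNReal.toReal_mul,
    ENNReal.toReal_ofReal (by linarith), ENNReal.toReal_ofReal (by linarith)]
  ring

lemma mem_cb {p q : ℝ × ℝ} {l : ℝ} : q ∈ closedBall p l ↔ |q.1 - p.1| ≤ l ∧ |q.2 - p.2| ≤ l := by
  rw [mem_closedBall, Prod.dist_eq, max_le_iff, Real.dist_eq, Real.dist_eq]

lemma scale_mem {p y : ℝ × ℝ} {r R : ℝ} (hy : y ∈ closedBall (0 : ℝ × ℝ) 1) (hr : |r| ≤ R) :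
    p + r • y ∈ closedBall p R := by
  rw [mem_closedBall_zero_iff] at hy
  rw [mem_closedBall, dist_eq_norm, add_sub_cancel_left, norm_smul, Real.norm_eq_abs]
  calc |r| * ‖y‖ ≤ |r| * 1 := by gcongr
    _ ≤ R := by linarith

/-- integration by parts against the radial bump -/
lemma ibp_bump {U : ℝ × ℝ → ℝ} {W : Set (ℝ × ℝ)} (hW : IsOpen W)
    (hU : ContDiffOn ℝ 2 U W) {p : ℝ × ℝ} {r : ℝ} (hQ : closedBall p |r| ⊆ W) :
    ∫ y in closedBall (0 : ℝ × ℝ) 1,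
      (dX U (p + r • y) * y.1 + dY U (p + r • y) * y.2) * bumpphi y =
    ∫ y in closedBall (0 : ℝ × ℝ) 1, bumpPhi y * (r * lapR U (p + r • y)) := by
  have hmem : ∀ y ∈ closedBall (0 : ℝ × ℝ) 1, p + r • y ∈ W := fun y hy => hQ (scale_mem hy le_rfl)
  have hcX : ContinuousOn (fun y => dX U (p + r • y)) (closedBall (0 : ℝ × ℝ) 1) :=
    (dX_contDiffOn hW hU).continuousOn.comp (by fun_prop) hmem
  have hcY : ContinuousOn (fun y => dY U (p + r • y)) (closedBall (0 : ℝ × ℝ) 1) :=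
    (dY_contDiffOn hW hU).continuousOn.comp (by fun_prop) hmem
  have hXX : ContinuousOn (dX (dX U)) W :=
    (((dX_contDiffOn hW hU).continuousOn_fderiv_of_isOpen hW (by norm_num)).clm_apply continuousOn_const)
  have hYY : ContinuousOn (dY (dY U)) W :=
    (((dY_contDiffOn hW hU).continuousOn_fderiv_of_isOpen hW (by norm_num)).clm_apply continuousOn_const)
  have hL : ContinuousOn (fun y => lapR U (p + r • y)) (closedBall (0 : ℝ × ℝ) 1) :=
    (hXX.add hYY).comp (by fun_prop) hmem
  have haff : ∀ y : ℝ × ℝ, HasFDerivAt (fun y : ℝ × ℝ => p + r • y)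
      (r • ContinuousLinearMap.id ℝ (ℝ × ℝ)) y := fun y =>
    ((hasFDerivAt_id y).const_smul r).const_add p
  have hdX : ∀ y ∈ closedBall (0 : ℝ × ℝ) 1, HasFDerivAt (fun y => dX U (p + r • y))
      ((fderiv ℝ (dX U) (p + r • y)).comp (r • ContinuousLinearMap.id ℝ (ℝ × ℝ))) y := fun y hy =>
    HasFDerivAt.comp (g := dX U) y ((((dX_contDiffOn hW hU).contDiffAt (hW.mem_nhds (hmem y hy))).differentiableAt
      (by norm_num)).hasFDerivAt) (haff y)
  have hdY : ∀ y ∈ closedBall (0 : ℝ × ℝ) 1, HasFDerivAt (fun y => dY U (p + r • y))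
      ((fderiv ℝ (dY U) (p + r • y)).comp (r • ContinuousLinearMap.id ℝ (ℝ × ℝ))) y := fun y hy =>
    HasFDerivAt.comp (g := dY U) y ((((dY_contDiffOn hW hU).contDiffAt (hW.mem_nhds (hmem y hy))).differentiableAt
      (by norm_num)).hasFDerivAt) (haff y)
  have hsub : Ioo (-1 : ℝ) 1 ×ˢ Ioo (-1 : ℝ) 1 ⊆ closedBall (0 : ℝ × ℝ) 1 := by
    rw [cb01, Icc_prod_eq]
    exact prod_mono Ioo_subset_Icc_self Ioo_subset_Icc_self
  have hdivpt : ∀ y : ℝ × ℝ,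
      (bumpPhi y • ((fderiv ℝ (dX U) (p + r • y)).comp (r • ContinuousLinearMap.id ℝ (ℝ × ℝ))) +
      dX U (p + r • y) • ((2 * max (1 - y.1 ^ 2 - y.2 ^ 2) 0) •
      (-(2 * y.1) • ContinuousLinearMap.fst ℝ ℝ ℝ - (2 * y.2) • ContinuousLinearMap.snd ℝ ℝ ℝ)) : ℝ × ℝ →L[ℝ] ℝ) (1, 0) +
      (bumpPhi y • ((fderiv ℝ (dY U) (p + r • y)).comp (r • ContinuousLinearMap.id ℝ (ℝ × ℝ))) +
      dY U (p + r • y) • ((2 * max (1 - y.1 ^ 2 - y.2 ^ 2) 0) •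
      (-(2 * y.1) • ContinuousLinearMap.fst ℝ ℝ ℝ - (2 * y.2) • ContinuousLinearMap.snd ℝ ℝ ℝ)) : ℝ × ℝ →L[ℝ] ℝ) (0, 1)
      = bumpPhi y * (r * lapR U (p + r • y)) -
        (dX U (p + r • y) * y.1 + dY U (p + r • y) * y.2) * bumpphi y := by
    intro y
    have e1 : fderiv ℝ (dX U) (p + r • y) (r, 0) = r * dX (dX U) (p + r • y) := by
      have : ((r, 0) : ℝ × ℝ) = r • (1, 0) := by simp
      rw [this, map_smul]; rfl
    have e2 : fderiv ℝ (dY U) (p + r • y) (0, r) = r * dY (dY U) (p + r • y) := by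
      have : ((0, r) : ℝ × ℝ) = r • (0, 1) := by simp
      rw [this, map_smul]; rfl
    change _ = r * fderiv ℝ (dX U) (p + r • y) (1, 0) at e1
    change _ = r * fderiv ℝ (dY U) (p + r • y) (0, 1) at e2
    simp [lapR, bumpphi]
    simp only [dX, dY]
    ring
  have hint1 : IntegrableOn (fun y => bumpPhi y * (r * lapR U (p + r • y))) (closedBall (0 : ℝ × ℝ) 1) :=
    (bumpPhi_cont.continuousOn.mul (continuousOn_const.mul hL)).integrableOn_compact
      (isCompact_closedBall _ _)
  have hint2 : IntegrableOn (fun y => (dX U (p + r • y) * y.1 + dY U (p + r • y) * y.2) * bumpphi y)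
      (closedBall (0 : ℝ × ℝ) 1) :=
    (((hcX.mul continuous_fst.continuousOn).add (hcY.mul continuous_snd.continuousOn)).mul
      bumpphi_cont.continuousOn).integrableOn_compact (isCompact_closedBall _ _)
  have key := integral_divergence_prod_Icc_of_hasFDerivAt_of_le
    (fun y => bumpPhi y * dX U (p + r • y)) (fun y => bumpPhi y * dY U (p + r • y))
    _ _ (-1, -1) (1, 1) (by simp [Prod.le_def]) (cb01 ▸ (bumpPhi_cont.continuousOn.mul hcX))
    (cb01 ▸ (bumpPhi_cont.continuousOn.mul hcY))
    (fun y hy => (hasFDerivAt_bumpPhi y).mul (hdX y (hsub hy)))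
    (fun y hy => (hasFDerivAt_bumpPhi y).mul (hdY y (hsub hy)))
    (by simp_rw [hdivpt]; rw [← cb01]; exact hint1.sub hint2)
  simp_rw [hdivpt] at key
  rw [← cb01, integral_sub hint1 hint2] at key
  have b1 : ∀ x : ℝ, bumpPhi (x, 1) = 0 := fun x => by
    simp only [bumpPhi]; rw [max_eq_right (by nlinarith [sq_nonneg x])]; simp
  have b2 : ∀ x : ℝ, bumpPhi (x, -1) = 0 := fun x => by
    simp only [bumpPhi]; rw [max_eq_right (by nlinarith [sq_nonneg x])]; simp
  have b3 : ∀ x : ℝ, bumpPhi (1, x) = 0 := fun x => by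
    simp only [bumpPhi]; rw [max_eq_right (by nlinarith [sq_nonneg x])]; simp
  have b4 : ∀ x : ℝ, bumpPhi (-1, x) = 0 := fun x => by
    simp only [bumpPhi]; rw [max_eq_right (by nlinarith [sq_nonneg x])]; simp
  simp only [b1, b2, b3, b4, zero_mul, intervalIntegral.integral_zero, sub_zero, add_zero] at key
  linarith

lemma bumpphi_nonneg (y : ℝ × ℝ) : 0 ≤ bumpphi y := by
  unfold bumpphi; positivity
lemma bumpphi_le (y : ℝ × ℝ) : bumpphi y ≤ 4 := by
  unfold bumpphi
  have : max (1 - y.1 ^ 2 - y.2 ^ 2) 0 ≤ 1 := max_le (by nlinarith [sq_nonneg y.1, sq_nonneg y.2]) (by norm_num)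
  linarith
lemma bumpPhi_nonneg (y : ℝ × ℝ) : 0 ≤ bumpPhi y := by
  unfold bumpPhi; positivity
lemma bumpPhi_le (y : ℝ × ℝ) : bumpPhi y ≤ 1 := by
  unfold bumpPhi
  have : max (1 - y.1 ^ 2 - y.2 ^ 2) 0 ≤ 1 := max_le (by nlinarith [sq_nonneg y.1, sq_nonneg y.2]) (by norm_num)
  have h0 : 0 ≤ max (1 - y.1 ^ 2 - y.2 ^ 2) 0 := le_max_right _ _
  nlinarith

lemma bumpphi_integral : 2 ≤ ∫ y in closedBall (0 : ℝ × ℝ) 1, bumpphi y := by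
  have h1 : ∫ y in closedBall (0 : ℝ × ℝ) (1 / 2), (2 : ℝ) = 2 := by
    rw [setIntegral_const, vol_cb _ (by norm_num)]; norm_num
  rw [← h1]
  calc ∫ y in closedBall (0 : ℝ × ℝ) (1 / 2), (2 : ℝ)
      ≤ ∫ y in closedBall (0 : ℝ × ℝ) (1 / 2), bumpphi y := by
        apply setIntegral_mono_on _ _ measurableSet_closedBall
        · intro y hy
          rw [mem_cb] at hy
          simp only [Prod.fst_zero, Prod.snd_zero, sub_zero] at hy
          have h1 := sq_le_sq' (abs_le.1 hy.1).1 (abs_le.1 hy.1).2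
          have h2 := sq_le_sq' (abs_le.1 hy.2).1 (abs_le.1 hy.2).2
          have := le_max_left (1 - y.1 ^ 2 - y.2 ^ 2) 0
          unfold bumpphi
          linarith
        · exact continuous_const.continuousOn.integrableOn_compact (isCompact_closedBall _ _)
        · exact bumpphi_cont.continuousOn.integrableOn_compact (isCompact_closedBall _ _)
    _ ≤ _ := by
        apply setIntegral_mono_set
        · exact bumpphi_cont.continuousOn.integrableOn_compact (isCompact_closedBall _ _)
        · exact ae_of_all _ bumpphi_nonneg
        · exact (closedBall_subset_closedBall (by norm_num)).eventuallyLE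

lemma scale_integral (G : ℝ × ℝ → ℝ) (p : ℝ × ℝ) {ρ : ℝ} (hρ : 0 < ρ) :
    ∫ y in closedBall (0 : ℝ × ℝ) 1, G (p + ρ • y) = (ρ ^ 2)⁻¹ * ∫ q in closedBall p ρ, G q := by
  have h1 := Measure.setIntegral_comp_smul_of_pos volume (fun y => G (p + y))
    (closedBall (0 : ℝ × ℝ) 1) hρ
  simp only [Module.finrank_prod, Module.finrank_self, smul_eq_mul] at h1
  rw [h1, smul_unitClosedBall_of_nonneg hρ.le]
  norm_num
  left
  have h2 := (measurePreserving_add_left (volume : Measure (ℝ × ℝ)) p).setIntegral_preimage_emb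
    (measurableEmbedding_addLeft p) G (closedBall p ρ)
  rw [← h2]
  congr 2
  ext y
  simp [dist_eq_norm]

lemma mean_value {U : ℝ × ℝ → ℝ} {W : Set (ℝ × ℝ)} (hW : IsOpen W)
    (hU : ContDiffOn ℝ 2 U W) {p : ℝ × ℝ} {ρ : ℝ} (hρ : 0 < ρ) (hQ : closedBall p (2 * ρ) ⊆ W)
    {A : ℝ} (hA : ∀ q ∈ closedBall p (2 * ρ), |lapR U q| ≤ A) (c : ℝ) :
    |U p - c| ≤ 2 * (ρ ^ 2)⁻¹ * (∫ q in closedBall p ρ, |U q - c|) + 2 * A * ρ ^ 2 := by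
  set S := closedBall (0 : ℝ × ℝ) 1 with hS
  have hSc : IsCompact S := isCompact_closedBall _ _
  have hcf : ContinuousOn (fderiv ℝ U) W := hU.continuousOn_fderiv_of_isOpen hW (by norm_num)
  obtain ⟨Cb, hCb⟩ := (isCompact_closedBall p (2 * ρ)).exists_bound_of_continuousOn (hcf.mono hQ)
  have hmem : ∀ r, |r| ≤ 2 * ρ → ∀ y ∈ S, p + r • y ∈ closedBall p (2 * ρ) := fun r hr y hy => scale_mem hy hr
  have hUc : ∀ r, |r| ≤ 2 * ρ → ContinuousOn (fun y => U (p + r • y)) S := fun r hr =>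
    hU.continuousOn.comp (by fun_prop) fun y hy => hQ (hmem r hr y hy)
  set h : ℝ → ℝ := fun r => ∫ y in S, (U (p + r • y) - c) * bumpphi y with hh
  have hintg : ∀ r, |r| ≤ 2 * ρ → IntegrableOn (fun y => (U (p + r • y) - c) * bumpphi y) S :=
    fun r hr => (((hUc r hr).sub continuousOn_const).mul bumpphi_cont.continuousOn).integrableOn_compact hSc
  have hder : ∀ r ∈ Icc 0 ρ, HasDerivAt h
      (∫ y in S, (dX U (p + r • y) * y.1 + dY U (p + r • y) * y.2) * bumpphi y) r := by
    intro r hr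
    have hnear : ∀ r' ∈ ball r ρ, |r'| ≤ 2 * ρ := by
      intro r' hr'
      rw [mem_ball, Real.dist_eq, abs_lt] at hr'
      rw [abs_le]; constructor <;> linarith [hr.1, hr.2]
    have hexp : ∀ q y : ℝ × ℝ, fderiv ℝ U q y = dX U q * y.1 + dY U q * y.2 := by
      intro q y
      have : y = y.1 • ((1, 0) : ℝ × ℝ) + y.2 • ((0, 1) : ℝ × ℝ) := by ext <;> simp
      conv_lhs => rw [this]
      rw [map_add, map_smul, map_smul, smul_eq_mul, smul_eq_mul, dX, dY]; ring
    simp_rw [← hexp]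
    refine (hasDerivAt_integral_of_dominated_loc_of_deriv_le (s := ball r ρ) (bound := fun _ => Cb * 4)
      (F := fun r y => (U (p + r • y) - c) * bumpphi y) (μ := volume.restrict S)
      (F' := fun r y => fderiv ℝ U (p + r • y) y * bumpphi y)
      (ball_mem_nhds r hρ) ?_ (hintg r (hnear r (mem_ball_self hρ))) ?_ ?_ ?_ ?_).2
    · filter_upwards [ball_mem_nhds r hρ] with r' hr'
      exact (hintg r' (hnear r' hr')).aestronglyMeasurable
    · have h1 : ContinuousOn (fun y => fderiv ℝ U (p + r • y)) S :=
        hcf.comp (by fun_prop) fun y hy => hQ (hmem r (hnear r (mem_ball_self hρ)) y hy)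
      exact (((h1.clm_apply continuousOn_id).mul bumpphi_cont.continuousOn).integrableOn_compact hSc).aestronglyMeasurable
    · refine (ae_restrict_iff' hSc.measurableSet).2 (ae_of_all _ fun y hy r' hr' => ?_)
      have h1 := hCb _ (hmem r' (hnear r' hr') y hy)
      have h2 := (fderiv ℝ U (p + r' • y)).le_opNorm y
      have h3 : ‖y‖ ≤ 1 := by simpa [hS] using hy
      have h4 : 0 ≤ Cb := (norm_nonneg _).trans h1
      rw [norm_mul, Real.norm_of_nonneg (bumpphi_nonneg y)]
      have h5 : ‖fderiv ℝ U (p + r' • y) y‖ ≤ Cb := by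
        calc _ ≤ _ := h2
          _ ≤ Cb * 1 := by gcongr
          _ = Cb := mul_one _
      exact mul_le_mul h5 (bumpphi_le y) (bumpphi_nonneg y) h4
    · exact continuous_const.continuousOn.integrableOn_compact hSc
    · refine (ae_restrict_iff' hSc.measurableSet).2 (ae_of_all _ fun y hy r' hr' => ?_)
      have h1 := hasFDerivAt_of hW hU (hQ (hmem r' (hnear r' hr') y hy))
      have h2 : HasDerivAt (fun r : ℝ => p + r • y) y r' := by
        simpa using ((hasDerivAt_id r').smul_const y).const_add p
      exact ((h1.comp_hasDerivAt r' h2).sub_const c).mul_const _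
  have hbd : ∀ r ∈ Ico 0 ρ,
      ‖∫ y in S, (dX U (p + r • y) * y.1 + dY U (p + r • y) * y.2) * bumpphi y‖ ≤ 4 * A * ρ := by
    intro r hr
    have hr2 : |r| ≤ 2 * ρ := by rw [abs_of_nonneg hr.1]; linarith [hr.2]
    rw [ibp_bump hW hU ((closedBall_subset_closedBall hr2).trans hQ)]
    have := norm_setIntegral_le_of_norm_le_const (μ := volume) (s := S) (C := A * ρ)
      (f := fun y => bumpPhi y * (r * lapR U (p + r • y))) hSc.measure_lt_top ?_
    · rw [vol_cb _ (by norm_num)] at this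
      linarith
    · intro y hy
      have h1 := hA _ (hmem r hr2 y hy)
      have hA0 : 0 ≤ A := (abs_nonneg _).trans h1
      rw [norm_mul, norm_mul, Real.norm_of_nonneg (bumpPhi_nonneg y), Real.norm_of_nonneg hr.1,
        Real.norm_eq_abs]
      calc bumpPhi y * (r * |lapR U (p + r • y)|) ≤ 1 * (ρ * A) := by
            have h2 : r * |lapR U (p + r • y)| ≤ ρ * A :=
              mul_le_mul hr.2.le h1 (abs_nonneg _) hρ.le
            exact mul_le_mul (bumpPhi_le y) h2 (mul_nonneg hr.1 (abs_nonneg _)) zero_le_one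
        _ = A * ρ := by ring
  have hmv := norm_image_sub_le_of_norm_deriv_le_segment' (fun r hr => (hder r hr).hasDerivWithinAt) hbd
    ρ ⟨hρ.le, le_rfl⟩
  have h0 : h 0 = (U p - c) * ∫ y in S, bumpphi y := by
    simp only [hh, zero_smul, add_zero]
    rw [integral_const_mul]
  have hρ' : |h ρ| ≤ 4 * ((ρ ^ 2)⁻¹ * ∫ q in closedBall p ρ, |U q - c|) := by
    rw [← scale_integral (fun q => |U q - c|) p hρ, ← integral_const_mul]
    change ‖∫ y in S, (U (p + ρ • y) - c) * bumpphi y‖ ≤ _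
    refine (norm_integral_le_integral_norm _).trans ?_
    have hr2 : |ρ| ≤ 2 * ρ := by rw [abs_of_pos hρ]; linarith
    refine integral_mono (hintg ρ hr2).norm ?_ ?_
    · exact (continuousOn_const.mul ((hUc ρ hr2).sub continuousOn_const).abs).integrableOn_compact hSc
    · intro y
      simp only
      rw [norm_mul, Real.norm_of_nonneg (bumpphi_nonneg y), mul_comm, Real.norm_eq_abs]
      exact mul_le_mul_of_nonneg_right (bumpphi_le y) (abs_nonneg _)
  have hI := bumpphi_integral
  rw [Real.norm_eq_abs, sub_zero] at hmv
  have h5 : |h 0| ≤ |h ρ| + 4 * A * ρ * ρ := by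
    have := abs_sub_abs_le_abs_sub (h 0) (h ρ)
    rw [abs_sub_comm] at this
    linarith
  rw [h0, abs_mul, abs_of_nonneg (by linarith : 0 ≤ ∫ y in S, bumpphi y)] at h5
  nlinarith [abs_nonneg (U p - c)]

lemma local_osc {U : ℝ × ℝ → ℝ} {W : Set (ℝ × ℝ)} (hW : IsOpen W)
    (hU : ContDiffOn ℝ 2 U W) {p z : ℝ × ℝ} {ρ : ℝ} (hρ : 0 < ρ) (hQ : closedBall p (3 * ρ) ⊆ W)
    {A : ℝ} (hA : ∀ q ∈ W, |lapR U q| ≤ A) {C0 : ℝ}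
    (hE : ∀ c M : ℝ, 0 < M → ∫ q in closedBall p (3 * ρ),
      M / (M ^ 2 + (U q - c) ^ 2) * (dX U q ^ 2 + dY U q ^ 2) ≤ C0)
    (hz : z ∈ closedBall p ρ) :
    |U p - U z| ≤ 4 * A * ρ ^ 2 + 2 * (36 + 5476 * C0 ^ 2) := by
  have hρ3 : 0 < 3 * ρ := by linarith
  obtain ⟨c, hc⟩ := poincare hW hU hρ3 hQ
  set Q := closedBall p (3 * ρ) with hQdef
  have hQc : IsCompact Q := isCompact_closedBall _ _
  set X := ∫ q in Q, (|dX U q| + |dY U q|) with hX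
  have hX0 : 0 ≤ X := integral_nonneg fun q => by positivity
  have hcU : ContinuousOn U Q := hU.continuousOn.mono hQ
  have hcX : ContinuousOn (dX U) Q := (dX_contDiffOn hW hU).continuousOn.mono hQ
  have hcY : ContinuousOn (dY U) Q := (dY_contDiffOn hW hU).continuousOn.mono hQ
  have hisq : IntegrableOn (fun q => (U q - c) ^ 2) Q :=
    ((hcU.sub continuousOn_const).pow 2).integrableOn_compact hQc
  have hconst : ∀ k : ℝ, IntegrableOn (fun _ : ℝ × ℝ => k) Q := fun k =>
    continuousOn_const.integrableOn_compact hQc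
  have hvol : volume.real Q = 36 * ρ ^ 2 := by rw [vol_cb _ hρ3.le]; ring
  have hC0 : 0 ≤ C0 := le_trans (integral_nonneg fun q => by positivity) (hE c 1 one_pos)
  have hXb : X ≤ 74 * C0 * ρ := by
    rcases hX0.eq_or_lt with h0 | hpos
    · rw [← h0]; positivity
    set M := X / ρ with hM
    have hMpos : 0 < M := by positivity
    set lam := 37 * ρ with hlam
    have hlpos : 0 < lam := by positivity
    have hiE : IntegrableOn (fun q => M / (M ^ 2 + (U q - c) ^ 2) * (dX U q ^ 2 + dY U q ^ 2)) Q := by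
      refine ContinuousOn.integrableOn_compact hQc ?_
      refine ContinuousOn.mul (continuousOn_const.div (continuousOn_const.add ((hcU.sub continuousOn_const).pow 2)) ?_)
        ((hcX.pow 2).add (hcY.pow 2))
      intro q _; positivity
    have hiS : IntegrableOn (fun q => M + M⁻¹ * (U q - c) ^ 2) Q := (hconst M).add (hisq.const_mul _)
    have h1 : X ≤ ∫ q in Q, (lam * (M / (M ^ 2 + (U q - c) ^ 2) * (dX U q ^ 2 + dY U q ^ 2)) +
        (2 * lam)⁻¹ * (M + M⁻¹ * (U q - c) ^ 2)) := by
      refine integral_mono ((hcX.abs.add hcY.abs).integrableOn_compact hQc)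
        ((hiE.const_mul _).add (hiS.const_mul _)) ?_
      intro q
      simp only
      set t := U q - c
      set w := M / (M ^ 2 + t ^ 2) with hw
      have hwpos : 0 < w := by positivity
      have e : M + M⁻¹ * t ^ 2 = w⁻¹ := by rw [hw]; field_simp
      rw [e]
      have key : ∀ a : ℝ, |a| ≤ lam * (w * a ^ 2) + (4 * lam)⁻¹ * w⁻¹ := by
        intro a
        have hm : 0 < lam * w := by positivity
        have : 0 ≤ (lam * w)⁻¹ * (lam * w * |a| - 1 / 2) ^ 2 := by positivity
        have e2 : (lam * w)⁻¹ * (lam * w * |a| - 1 / 2) ^ 2 =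
          lam * (w * |a| ^ 2) + (4 * lam)⁻¹ * w⁻¹ - |a| := by field_simp; ring
        rw [e2, sq_abs] at this
        linarith
      have k1 := key (dX U q)
      have k2 := key (dY U q)
      have e3 : (2 * lam)⁻¹ * w⁻¹ = (4 * lam)⁻¹ * w⁻¹ + (4 * lam)⁻¹ * w⁻¹ := by field_simp; norm_num
      rw [e3]; linarith
    rw [integral_add (hiE.const_mul _) (hiS.const_mul _),
      integral_const_mul, integral_const_mul, integral_add (hconst M) (hisq.const_mul _),
      integral_const_mul, setIntegral_const, hvol, smul_eq_mul] at h1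
    have h2 := hE c M hMpos
    have h3 : 36 * ρ ^ 2 * M + M⁻¹ * ∫ q in Q, (U q - c) ^ 2 ≤ 37 * ρ * X := by
      have : M⁻¹ * ∫ q in Q, (U q - c) ^ 2 ≤ M⁻¹ * X ^ 2 := by gcongr
      have e4 : M⁻¹ * X ^ 2 = ρ * X := by rw [hM]; field_simp
      have e5 : 36 * ρ ^ 2 * M = 36 * ρ * X := by rw [hM]; field_simp
      linarith
    have h4 : X ≤ lam * C0 + (2 * lam)⁻¹ * (37 * ρ * X) := by
      refine h1.trans ?_
      gcongr
    have e6 : (2 * lam)⁻¹ * (37 * ρ * X) = X / 2 := by rw [hlam]; field_simp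
    rw [e6] at h4
    linarith
  have hL1 : ∫ q in Q, |U q - c| ≤ ρ ^ 2 * (18 + 2738 * C0 ^ 2) := by
    have h1 : ∫ q in Q, |U q - c| ≤ ∫ q in Q, (1 / 2 + (1 / 2) * (U q - c) ^ 2) := by
      refine integral_mono ((hcU.sub continuousOn_const).abs.integrableOn_compact hQc)
        ((hconst _).add (hisq.const_mul _)) ?_
      intro q
      simp only
      have := sq_nonneg (|U q - c| - 1)
      have h2 := sq_abs (U q - c)
      nlinarith
    rw [integral_add (hconst _) (hisq.const_mul _), integral_const_mul, setIntegral_const, hvol, smul_eq_mul] at h1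
    have h2 : X ^ 2 ≤ (74 * C0 * ρ) ^ 2 := by gcongr
    nlinarith
  have hpt : ∀ x ∈ closedBall p ρ, |U x - c| ≤ 2 * A * ρ ^ 2 + (36 + 5476 * C0 ^ 2) := by
    intro x hx
    have hd : dist x p ≤ ρ := hx
    have hs : closedBall x (2 * ρ) ⊆ Q := closedBall_subset_closedBall' (by linarith)
    have hs1 : closedBall x ρ ⊆ Q := closedBall_subset_closedBall' (by linarith)
    have h1 := mean_value hW hU hρ (hs.trans hQ) (fun q hq => hA q (hQ (hs hq))) c
    have h2 : ∫ q in closedBall x ρ, |U q - c| ≤ ∫ q in Q, |U q - c| := by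
      apply setIntegral_mono_set
      · exact (hcU.sub continuousOn_const).abs.integrableOn_compact hQc
      · exact ae_of_all _ fun x => abs_nonneg _
      · exact hs1.eventuallyLE
    have h3 : 2 * (ρ ^ 2)⁻¹ * (∫ q in closedBall x ρ, |U q - c|) ≤
        2 * (ρ ^ 2)⁻¹ * (ρ ^ 2 * (18 + 2738 * C0 ^ 2)) := by
      gcongr; exact h2.trans hL1
    have e : 2 * (ρ ^ 2)⁻¹ * (ρ ^ 2 * (18 + 2738 * C0 ^ 2)) = 36 + 5476 * C0 ^ 2 := by
      field_simp; ring
    linarith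
  have h1 := hpt p (mem_closedBall_self hρ.le)
  have h2 := hpt z hz
  have h3 := abs_sub_le (U p) c (U z)
  rw [abs_sub_comm c] at h3
  linarith

def cut (t : ℝ) : ℝ := Real.smoothTransition (t - 1)

lemma cut_contDiff : ContDiff ℝ 2 cut := by
  unfold cut
  exact (Real.smoothTransition.contDiff).comp (contDiff_id.sub contDiff_const)
lemma cut_zero {t : ℝ} (h : t ≤ 1) : cut t = 0 := Real.smoothTransition.zero_of_nonpos (by linarith)
lemma cut_one {t : ℝ} (h : 2 ≤ t) : cut t = 1 := Real.smoothTransition.one_of_one_le (by linarith)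
lemma cut_nonneg (t : ℝ) : 0 ≤ cut t := Real.smoothTransition.nonneg _
lemma cut_le_one (t : ℝ) : cut t ≤ 1 := Real.smoothTransition.le_one _
lemma dcut_cont : Continuous (deriv cut) := cut_contDiff.continuous_deriv (by norm_num)
lemma dcut_zero {t : ℝ} (h : t < 1) : deriv cut t = 0 := by
  have : cut =ᶠ[𝓝 t] fun _ => 0 := by
    filter_upwards [gt_mem_nhds h] with s hs using cut_zero hs.le
  rw [this.deriv_eq]; simp
lemma dcut_zero' {t : ℝ} (h : 2 < t) : deriv cut t = 0 := by
  have : cut =ᶠ[𝓝 t] fun _ => 1 := by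
    filter_upwards [lt_mem_nhds h] with s hs using cut_one hs.le
  rw [this.deriv_eq]; simp
lemma cut_hasDeriv (t : ℝ) : HasDerivAt cut (deriv cut t) t :=
  (cut_contDiff.differentiable (by norm_num) t).hasDerivAt
lemma dcut_bound : ∃ C, 0 ≤ C ∧ ∀ t, |deriv cut t| ≤ C := by
  obtain ⟨C, hC⟩ := (isCompact_Icc (a := (1 : ℝ)) (b := 2)).exists_bound_of_continuousOn dcut_cont.continuousOn
  refine ⟨C, (norm_nonneg _).trans (hC 1 (by norm_num)), fun t => ?_⟩
  by_cases h1 : t < 1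
  · rw [dcut_zero h1, abs_zero]; exact (norm_nonneg _).trans (hC 1 (by norm_num))
  by_cases h2 : 2 < t
  · rw [dcut_zero' h2, abs_zero]; exact (norm_nonneg _).trans (hC 1 (by norm_num))
  exact hC t ⟨not_lt.1 h1, not_lt.1 h2⟩

section
variable {H U : ℝ × ℝ → ℝ}

lemma cutmul_cont (hH : Continuous H) {s : ℝ} (hs : 0 < s) {k : ℝ → ℝ} (hk : Continuous k)
    (hk0 : ∀ t < 1, k t = 0) {G : ℝ × ℝ → ℝ} (hG : ContinuousOn G {q | H q ≠ 0}) :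
    Continuous fun q => k (H q / s) * G q := by
  rw [continuous_iff_continuousAt]
  intro q
  by_cases hq : H q = 0
  · have : (fun q => k (H q / s) * G q) =ᶠ[𝓝 q] fun _ => 0 := by
      have h1 : ∀ᶠ x in 𝓝 q, H x / s < 1 :=
        (hH.div_const s).continuousAt.eventually_lt continuousAt_const (by simp [hq])
      filter_upwards [h1] with x hx
      rw [hk0 _ hx, zero_mul]
    exact continuousAt_const.congr this.symm
  · have ho : IsOpen {q | H q ≠ 0} := isOpen_ne_fun hH continuous_const
    exact (hk.comp (hH.div_const s)).continuousAt.mul (hG.continuousAt (ho.mem_nhds hq))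

lemma cutmul_contDiff (hH : ContDiff ℝ 2 H) {s : ℝ} (hs : 0 < s)
    {G : ℝ × ℝ → ℝ} (hG : ContDiffOn ℝ 1 G {q | H q ≠ 0}) :
    ContDiff ℝ 1 fun q => cut (H q / s) * G q := by
  rw [contDiff_iff_contDiffAt]
  intro q
  by_cases hq : H q = 0
  · have : (fun q => cut (H q / s) * G q) =ᶠ[𝓝 q] fun _ => 0 := by
      have h1 : ∀ᶠ x in 𝓝 q, H x / s < 1 :=
        (hH.continuous.div_const s).continuousAt.eventually_lt continuousAt_const (by simp [hq])
      filter_upwards [h1] with x hx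
      rw [cut_zero hx.le, zero_mul]
    exact contDiffAt_const.congr_of_eventuallyEq this
  · have ho : IsOpen {q | H q ≠ 0} := isOpen_ne_fun hH.continuous continuous_const
    refine ContDiffAt.mul ?_ (hG.contDiffAt (ho.mem_nhds hq))
    exact ((cut_contDiff.comp (hH.div_const s)).of_le (by norm_num)).contDiffAt

lemma D_eq (L : ℝ) : closedBall (0 : ℝ × ℝ) L = Icc (-L, -L) (L, L) := by
  rw [show (0 : ℝ × ℝ) = (0, 0) from rfl, ← closedBall_prod_same, Real.closedBall_eq_Icc, Icc_prod_eq]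
  simp

lemma div_zero_periodic {F G : ℝ × ℝ → ℝ} (hF : ContDiff ℝ 1 F) (hG : ContDiff ℝ 1 G) {L : ℝ}
    (hL : 0 ≤ L) (pF : ∀ y, F (L, y) = F (-L, y)) (pG : ∀ x, G (x, L) = G (x, -L)) :
    ∫ q in closedBall (0 : ℝ × ℝ) L, (dX F q + dY G q) = 0 := by
  have key := integral_divergence_prod_Icc_of_hasFDerivAt_of_le F G (fderiv ℝ F) (fderiv ℝ G)
    (-L, -L) (L, L) (by simp [Prod.le_def]; linarith) hF.continuous.continuousOn hG.continuous.continuousOn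
    (fun q _ => (hF.differentiable (by norm_num) q).hasFDerivAt)
    (fun q _ => (hG.differentiable (by norm_num) q).hasFDerivAt) ?_
  · rw [D_eq]
    simp only [dX, dY]
    rw [key]
    simp only [pF, pG]
    ring
  · refine ContinuousOn.integrableOn_compact (by rw [← D_eq]; exact isCompact_closedBall _ _) (Continuous.continuousOn ?_)
    exact ((hF.continuous_fderiv (by norm_num)).clm_apply continuous_const).add
      ((hG.continuous_fderiv (by norm_num)).clm_apply continuous_const)

lemma dX_periodic {U : ℝ × ℝ → ℝ} {v : ℝ × ℝ} (h : ∀ q, U (q + v) = U q) (q : ℝ × ℝ) :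
    dX U (q + v) = dX U q := by
  have : (fun q => U (q + v)) = U := funext h
  unfold dX
  rw [← fderiv_comp_add_right, this]

lemma dY_periodic {U : ℝ × ℝ → ℝ} {v : ℝ × ℝ} (h : ∀ q, U (q + v) = U q) (q : ℝ × ℝ) :
    dY U (q + v) = dY U q := by
  have : (fun q => U (q + v)) = U := funext h
  unfold dY
  rw [← fderiv_comp_add_right, this]

lemma dX_unique {F : ℝ × ℝ → ℝ} {x y d : ℝ} (hF : DifferentiableAt ℝ F (x, y))
    (h : HasDerivAt (fun t => F (t, y)) d x) : dX F (x, y) = d := by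
  have h1 : HasDerivAt (fun t : ℝ => (t, y)) ((1 : ℝ), (0 : ℝ)) x :=
    (hasDerivAt_id x).prodMk (hasDerivAt_const x y)
  exact (hF.hasFDerivAt.comp_hasDerivAt x h1).unique h

lemma dY_unique {F : ℝ × ℝ → ℝ} {x y d : ℝ} (hF : DifferentiableAt ℝ F (x, y))
    (h : HasDerivAt (fun t => F (x, t)) d y) : dY F (x, y) = d := by
  have h1 : HasDerivAt (fun t : ℝ => (x, t)) ((0 : ℝ), (1 : ℝ)) y :=
    (hasDerivAt_const y x).prodMk (hasDerivAt_id y)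
  exact (hF.hasFDerivAt.comp_hasDerivAt y h1).unique h

/-- one-variable computation -/
lemma calc1 {h u v : ℝ → ℝ} {h' u' v' x s c M : ℝ} (hM : 0 < M)
    (hh : HasDerivAt h h' x) (hu : HasDerivAt u u' x) (hv : HasDerivAt v v' x) :
    HasDerivAt (fun t => cut (h t / s) * (arctan ((u t - c) / M) * v t))
      (deriv cut (h x / s) * (s⁻¹ * h' * v x * arctan ((u x - c) / M)) +
       cut (h x / s) * (M / (M ^ 2 + (u x - c) ^ 2) * (u' * v x)) +
       cut (h x / s) * (arctan ((u x - c) / M) * v')) x := by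
  have h1 := (cut_hasDeriv (h x / s)).comp x (hh.div_const s)
  have h2 := ((hu.sub_const c).div_const M).arctan
  refine (h1.mul (h2.mul hv)).congr_deriv ?_
  simp only [Function.comp, Pi.mul_apply]
  have : 1 / (1 + ((u x - c) / M) ^ 2) * (u' / M) = M / (M ^ 2 + (u x - c) ^ 2) * u' := by
    have : M ^ 2 + (u x - c) ^ 2 ≠ 0 := by positivity
    field_simp
  rw [this, div_eq_mul_inv]
  ring

lemma energy_id (hH : ContDiff ℝ 2 H) (hU : ContDiffOn ℝ 2 U {q | H q ≠ 0}) {L : ℝ} (hL : 0 ≤ L)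
    (pH1 : ∀ q, H (q + (2 * L, 0)) = H q) (pH2 : ∀ q, H (q + (0, 2 * L)) = H q)
    (pU1 : ∀ q, U (q + (2 * L, 0)) = U q) (pU2 : ∀ q, U (q + (0, 2 * L)) = U q)
    {s : ℝ} (hs : 0 < s) (c : ℝ) {M : ℝ} (hM : 0 < M) :
    (∫ q in closedBall (0 : ℝ × ℝ) L, deriv cut (H q / s) * (s⁻¹ *
        (dX H q * dX U q + dY H q * dY U q) * arctan ((U q - c) / M))) +
    (∫ q in closedBall (0 : ℝ × ℝ) L, cut (H q / s) *
        (M / (M ^ 2 + (U q - c) ^ 2) * (dX U q ^ 2 + dY U q ^ 2))) +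
    (∫ q in closedBall (0 : ℝ × ℝ) L, cut (H q / s) * (arctan ((U q - c) / M) * lapR U q)) = 0 := by
  have ho : IsOpen {q | H q ≠ 0} := isOpen_ne_fun hH.continuous continuous_const
  have hcX := dX_contDiffOn ho hU
  have hcY := dY_contDiffOn ho hU
  have hat : ContDiffOn ℝ 1 (fun q => arctan ((U q - c) / M)) {q | H q ≠ 0} :=
    (((hU.of_le (by norm_num)).sub contDiffOn_const).div_const M).arctan
  have hF := cutmul_contDiff hH hs (hat.mul hcX)
  have hG := cutmul_contDiff hH hs (hat.mul hcY)
  have e1 : ∀ y : ℝ, ((L, y) : ℝ × ℝ) = (-L, y) + (2 * L, 0) := fun y => by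
    ext <;> simp; ring
  have e2 : ∀ x : ℝ, ((x, L) : ℝ × ℝ) = (x, -L) + (0, 2 * L) := fun y => by
    ext <;> simp; ring
  have key := div_zero_periodic hF hG hL
    (fun y => by rw [e1, pH1, pU1, dX_periodic pU1]) (fun x => by rw [e2, pH2, pU2, dY_periodic pU2])
  have hXX : ContinuousOn (dX (dX U)) {q | H q ≠ 0} :=
    (hcX.continuousOn_fderiv_of_isOpen ho (by norm_num)).clm_apply continuousOn_const
  have hYY : ContinuousOn (dY (dY U)) {q | H q ≠ 0} :=
    (hcY.continuousOn_fderiv_of_isOpen ho (by norm_num)).clm_apply continuousOn_const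
  have cdXH : Continuous (dX H) := (hH.continuous_fderiv (by norm_num)).clm_apply continuous_const
  have cdYH : Continuous (dY H) := (hH.continuous_fderiv (by norm_num)).clm_apply continuous_const
  have c1 := cutmul_cont hH.continuous hs dcut_cont (fun t ht => dcut_zero ht)
    (((continuousOn_const (c := s⁻¹)).mul ((cdXH.continuousOn.mul hcX.continuousOn).add (cdYH.continuousOn.mul hcY.continuousOn))).mul hat.continuousOn)
  have c2 := cutmul_cont hH.continuous hs cut_contDiff.continuous (fun t ht => cut_zero ht.le)
    (((continuousOn_const (c := M)).div (((continuousOn_const (c := M ^ 2)).add ((hU.continuousOn.sub (continuousOn_const (c := c))).pow 2)))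
      (fun q _ => (show M ^ 2 + (U q - c) ^ 2 ≠ 0 by positivity))).mul ((hcX.continuousOn.pow 2).add (hcY.continuousOn.pow 2)))
  have c3 := cutmul_cont hH.continuous hs cut_contDiff.continuous (fun t ht => cut_zero ht.le)
    (hat.continuousOn.mul (hXX.add hYY))
  have hcomp := isCompact_closedBall (0 : ℝ × ℝ) L
  have i1 := c1.continuousOn.integrableOn_compact (μ := volume) hcomp
  have i2 := c2.continuousOn.integrableOn_compact (μ := volume) hcomp
  have i3 := c3.continuousOn.integrableOn_compact (μ := volume) hcomp
  have s1 := integral_add i1 i2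
  have s2 := integral_add (i1.add i2) i3
  refine Eq.trans ?_ key
  refine Eq.trans (congrArg₂ (· + ·) s1.symm rfl) ?_
  refine s2.symm.trans ?_
  refine integral_congr_ae (ae_of_all _ ?_)
  rintro ⟨x, y⟩
  by_cases hq : H (x, y) = 0
  · have z1 : ∀ G : ℝ × ℝ → ℝ, (fun q => cut (H q / s) * G q) =ᶠ[𝓝 (x, y)] fun _ => 0 := by
      intro G
      have h1 : ∀ᶠ x in 𝓝 (x, y), H x / s < 1 :=
        (hH.continuous.div_const s).continuousAt.eventually_lt continuousAt_const (by simp [hq])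
      filter_upwards [h1] with x hx
      rw [cut_zero hx.le, zero_mul]
    simp only [dX, dY]
    rw [(z1 _).fderiv_eq, (z1 _).fderiv_eq]
    simp [hq, cut_zero, dcut_zero]
  · have hHd := (hH.differentiable (by norm_num) (x, y))
    have hHo : ContDiffOn ℝ 2 H {q | H q ≠ 0} := hH.contDiffOn
    have dd : ∀ {V : ℝ × ℝ → ℝ}, ContDiffOn ℝ 1 V {q | H q ≠ 0} → HasFDerivAt V (fderiv ℝ V (x, y)) (x, y) := fun {V} hV =>
      ((hV.contDiffAt (ho.mem_nhds hq)).differentiableAt (by norm_num)).hasFDerivAt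
    have l1 : HasDerivAt (fun t : ℝ => (t, y)) ((1 : ℝ), (0 : ℝ)) x :=
      (hasDerivAt_id x).prodMk (hasDerivAt_const x y)
    have l2 : HasDerivAt (fun t : ℝ => (x, t)) ((0 : ℝ), (1 : ℝ)) y :=
      (hasDerivAt_const y x).prodMk (hasDerivAt_id y)
    have l3 : HasDerivAt (fun t => dX U (t, y)) (dX (dX U) (x, y)) x := by
      have := (dd hcX).comp_hasDerivAt x l1
      exact this
    have l4 : HasDerivAt (fun t => dY U (x, t)) (dY (dY U) (x, y)) y := by
      have := (dd hcY).comp_hasDerivAt y l2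
      exact this
    have hx := dX_unique (hF.differentiable (by norm_num) (x, y)) (calc1 (s := s) (c := c) hM
      (hasDerivAt_fst ho hHo hq) (hasDerivAt_fst ho hU hq) l3)
    have hy := dY_unique (hG.differentiable (by norm_num) (x, y)) (calc1 (s := s) (c := c) hM
      (hasDerivAt_snd ho hHo hq) (hasDerivAt_snd ho hU hq) l4)
    simp only [] at hx hy ⊢
    rw [hx, hy]
    simp only [lapR, Pi.add_apply, Pi.mul_apply, Pi.div_apply, Pi.sub_apply, Pi.pow_apply]
    ring
end

def Cτ (τ : ℝ) : ℝ := τ⁻¹ * (τ⁻¹ + 1)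

lemma Cτ_pos {τ : ℝ} (hτ : 0 < τ) : 0 < Cτ τ := by unfold Cτ; positivity

lemma f_aux {τ : ℝ} (hτ : 0 < τ) {t m : ℝ} (h : |1 - exp t| ≤ m * (1 + exp t)) :
    |fτ τ t| ≤ Cτ τ * m := by
  unfold fτ Cτ
  set e := exp t with he
  have hp : 0 < e := exp_pos t
  have hm : 0 ≤ m := by
    by_contra hm
    have := abs_nonneg (1 - e)
    nlinarith
  rw [abs_div, abs_mul, abs_of_pos hp, abs_of_pos (by positivity : 0 < (τ + e) ^ 3),
    div_le_iff₀ (by positivity)]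
  have h1 : 1 + e ≤ (τ⁻¹ + 1) * (τ + e) := by
    have : (τ⁻¹ + 1) * (τ + e) = 1 + e + (τ + τ⁻¹ * e) := by field_simp; ring
    rw [this]
    have : 0 ≤ τ + τ⁻¹ * e := by positivity
    linarith
  have h2 : 1 ≤ τ⁻¹ * (τ + e) := by
    have : τ⁻¹ * (τ + e) = 1 + τ⁻¹ * e := by field_simp
    rw [this]
    have : 0 ≤ τ⁻¹ * e := by positivity
    linarith
  calc e * |1 - e| ≤ (τ + e) * (m * ((τ⁻¹ + 1) * (τ + e))) := by
        gcongr
        · linarith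
        · exact h.trans (by gcongr)
    _ = (τ + e) * (m * ((τ⁻¹ + 1) * (τ + e))) * 1 := by ring
    _ ≤ (τ + e) * (m * ((τ⁻¹ + 1) * (τ + e))) * (τ⁻¹ * (τ + e)) := by gcongr
    _ = _ := by ring

lemma f_bound {τ : ℝ} (hτ : 0 < τ) (t : ℝ) : |fτ τ t| ≤ Cτ τ := by
  have := f_aux hτ (t := t) (m := 1) (by
    have := exp_pos t
    rw [abs_le]; constructor <;> linarith)
  simpa using this

lemma f_bound' {τ : ℝ} (hτ : 0 < τ) (t : ℝ) : |fτ τ t| ≤ Cτ τ * |t| := by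
  refine f_aux hτ ?_
  have hp := exp_pos t
  rcases le_total 0 t with h | h
  · have h1 := add_one_le_exp (-t)
    have h2 : exp t * exp (-t) = 1 := by rw [← exp_add]; simp
    have h3 : 1 ≤ exp t := one_le_exp h
    rw [abs_of_nonneg h, abs_of_nonpos (by linarith)]
    nlinarith
  · have h1 := add_one_le_exp t
    have h3 : exp t ≤ 1 := exp_le_one_iff.2 h
    rw [abs_of_nonpos h, abs_of_nonneg (by linarith)]
    nlinarith

lemma f_cont {τ : ℝ} (hτ : 0 < τ) : Continuous (fτ τ) := by
  unfold fτ
  refine Continuous.div (by fun_prop) (by fun_prop) fun t => ?_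
  have := exp_pos t
  positivity

lemma arctan_le_id {y : ℝ} (hy : 0 ≤ y) : arctan y ≤ y := by
  have h1 : 0 ≤ arctan y := by
    rw [← arctan_zero]; exact arctan_strictMono.monotone hy
  have := Real.le_tan h1 (arctan_lt_pi_div_two y)
  rwa [tan_arctan] at this

lemma f_arctan {τ : ℝ} (hτ : 0 < τ) {M : ℝ} (hM : 0 < M) (t : ℝ) :
    π / 2 * |fτ τ t| ≤ -(arctan (t / M) * fτ τ t) + Cτ τ * M := by
  have key : ∀ x : ℝ, 0 < x → (π / 2 - arctan (x / M)) * (Cτ τ * x) ≤ Cτ τ * M := by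
    intro x hx
    have h1 := arctan_inv_of_pos (show 0 < x / M by positivity)
    have h2 := arctan_le_id (show 0 ≤ (x / M)⁻¹ by positivity)
    rw [← h1]
    have hC := Cτ_pos hτ
    calc arctan (x / M)⁻¹ * (Cτ τ * x) ≤ (x / M)⁻¹ * (Cτ τ * x) := by gcongr
      _ = Cτ τ * M := by field_simp
  have hC := Cτ_pos hτ
  have hfb := f_bound' hτ t
  rcases lt_trichotomy t 0 with h | h | h
  · have hs : 0 ≤ fτ τ t := by
      unfold fτ
      have : exp t ≤ 1 := exp_le_one_iff.2 h.le
      have := exp_pos t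
      apply div_nonneg <;> [apply mul_nonneg; skip] <;> [linarith; linarith; positivity]
    have k := key (-t) (by linarith)
    rw [abs_of_nonneg hs] at *
    rw [abs_of_neg h] at hfb
    rw [neg_div, arctan_neg] at k
    have h3 := neg_pi_div_two_lt_arctan (t / M)
    have := mul_le_mul_of_nonneg_left hfb (show 0 ≤ π / 2 - -arctan (t / M) by linarith)
    linarith
  · subst h; simp [fτ]; positivity
  · have hs : fτ τ t ≤ 0 := by
      unfold fτ
      have : 1 ≤ exp t := one_le_exp h.le
      have := exp_pos t
      apply div_nonpos_of_nonpos_of_nonneg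
      · apply mul_nonpos_of_nonneg_of_nonpos <;> linarith
      · positivity
    have k := key t h
    rw [abs_of_nonpos hs] at *
    rw [abs_of_pos h] at hfb
    have h3 := arctan_lt_pi_div_two (t / M)
    have := mul_le_mul_of_nonneg_left hfb (show 0 ≤ π / 2 - arctan (t / M) by linarith)
    linarith

lemma abs_arctan_le (x : ℝ) : |arctan x| ≤ π / 2 :=
  abs_le.2 ⟨(neg_pi_div_two_lt_arctan x).le, (arctan_lt_pi_div_two x).le⟩

lemma energy_final {H U : ℝ × ℝ → ℝ} (hH : ContDiff ℝ 2 H) (hU : ContDiffOn ℝ 2 U {q | H q ≠ 0})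
    (hH0 : ∀ q, 0 ≤ H q) {L : ℝ} (hL : 0 ≤ L)
    (pH1 : ∀ q, H (q + (2 * L, 0)) = H q) (pH2 : ∀ q, H (q + (0, 2 * L)) = H q)
    (pU1 : ∀ q, U (q + (2 * L, 0)) = U q) (pU2 : ∀ q, U (q + (0, 2 * L)) = U q)
    {CH : ℝ} (hCH : ∀ t > 0, volume.real (closedBall (0 : ℝ × ℝ) L ∩ {q | H q ≤ t}) ≤ CH * t)
    {M0 s0 : ℝ} (hM0 : 0 ≤ M0) (hG : ∀ q ∈ closedBall (0 : ℝ × ℝ) L, 0 < H q → H q < s0 →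
      |dX H q * dX U q + dY H q * dY U q| ≤ M0)
    {s : ℝ} (hs : 0 < s) (hss : 2 * s < s0) {Cφ : ℝ} (hCφ0 : 0 ≤ Cφ) (hCφ : ∀ t, |deriv cut t| ≤ Cφ)
    {τ k : ℝ} (hτ : 0 < τ) (hk : 0 < k) (hlap : ∀ q, H q ≠ 0 → lapR U q = -(k * fτ τ (U q)))
    {Q : Set (ℝ × ℝ)} (hQm : MeasurableSet Q) (hQD : Q ⊆ closedBall (0 : ℝ × ℝ) L)
    (hQs : ∀ q ∈ Q, 2 * s ≤ H q) (c : ℝ) {M : ℝ} (hM : 0 < M) :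
    ∫ q in Q, M / (M ^ 2 + (U q - c) ^ 2) * (dX U q ^ 2 + dY U q ^ 2) ≤
      π / 2 * (Cφ * M0 * π * CH + 1) + Cφ * M0 * π * CH := by
  set D := closedBall (0 : ℝ × ℝ) L with hD
  have hDc : IsCompact D := isCompact_closedBall _ _
  have hpi := pi_pos
  have first : ∀ (c M : ℝ), |∫ q in D, deriv cut (H q / s) * (s⁻¹ *
        (dX H q * dX U q + dY H q * dY U q) * arctan ((U q - c) / M))| ≤ Cφ * M0 * π * CH := by
    intro c M
    have hms : MeasurableSet {q | H q ≤ 2 * s} := (isClosed_le hH.continuous continuous_const).measurableSet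
    set B := Cφ * (s⁻¹ * M0 * (π / 2)) with hB
    have hB0 : 0 ≤ B := by positivity
    have h1 : ‖∫ q in D, deriv cut (H q / s) * (s⁻¹ *
        (dX H q * dX U q + dY H q * dY U q) * arctan ((U q - c) / M))‖ ≤
        ∫ q in D, indicator {q | H q ≤ 2 * s} (fun _ => B) q := by
      apply norm_integral_le_of_norm_le
      · exact (continuousOn_const.integrableOn_compact hDc).indicator hms
      · filter_upwards [ae_restrict_mem hDc.measurableSet] with q hq
        by_cases h2 : H q ≤ 2 * s
        · rw [indicator_of_mem (by exact h2)]
          by_cases h3 : H q = 0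
          · rw [h3, zero_div, dcut_zero (by norm_num)]; simpa using hB0
          · have h4 : 0 < H q := lt_of_le_of_ne (hH0 q) (Ne.symm h3)
            rw [Real.norm_eq_abs, abs_mul, abs_mul, abs_mul, abs_of_pos (inv_pos.2 hs), hB]
            gcongr
            · exact hCφ _
            · exact hG q hq h4 (by linarith)
            · exact abs_arctan_le _
        · rw [indicator_of_notMem (by exact h2), dcut_zero']
          · simp
          · rw [lt_div_iff₀ hs]; linarith
    rw [integral_indicator hms, Measure.restrict_restrict hms, setIntegral_const, smul_eq_mul, inter_comm] at h1
    rw [← Real.norm_eq_abs]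
    refine h1.trans ?_
    calc _ ≤ CH * (2 * s) * B := by gcongr; exact hCH _ (by positivity)
      _ = _ := by rw [hB]; field_simp
  set C1 := Cφ * M0 * π * CH with hC1
  have ho : IsOpen {q | H q ≠ 0} := isOpen_ne_fun hH.continuous continuous_const
  have hcX := (dX_contDiffOn ho hU).continuousOn
  have hcY := (dY_contDiffOn ho hU).continuousOn
  have hfU : ContinuousOn (fun q => k * |fτ τ (U q)|) {q | H q ≠ 0} :=
    continuousOn_const.mul ((f_cont hτ).comp_continuousOn hU.continuousOn).abs
  have cf := cutmul_cont hH.continuous hs cut_contDiff.continuous (fun t ht => cut_zero ht.le) hfU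
  have intf : IntegrableOn (fun q => cut (H q / s) * (k * |fτ τ (U q)|)) D :=
    cf.continuousOn.integrableOn_compact hDc
  have cE : ∀ (c : ℝ) {M : ℝ}, 0 < M → Continuous fun q => cut (H q / s) *
      (M / (M ^ 2 + (U q - c) ^ 2) * (dX U q ^ 2 + dY U q ^ 2)) := fun c M hM =>
    cutmul_cont hH.continuous hs cut_contDiff.continuous (fun t ht => cut_zero ht.le)
    (((continuousOn_const (c := M)).div (((continuousOn_const (c := M ^ 2)).add ((hU.continuousOn.sub (continuousOn_const (c := c))).pow 2)))
      (fun q _ => (show M ^ 2 + (U q - c) ^ 2 ≠ 0 by positivity))).mul ((hcX.pow 2).add (hcY.pow 2)))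
  have e3 : ∀ c M : ℝ, (fun q => cut (H q / s) * (arctan ((U q - c) / M) * lapR U q)) =
      fun q => cut (H q / s) * (arctan ((U q - c) / M) * (-(k * fτ τ (U q)))) := by
    intro c M
    funext q
    by_cases h : H q = 0
    · rw [h, zero_div, cut_zero (by norm_num)]; simp
    · rw [hlap q h]
  have c3 : ∀ c M : ℝ, IntegrableOn (fun q => cut (H q / s) * (arctan ((U q - c) / M) * (-(k * fτ τ (U q))))) D := by
    intro c M
    have : Continuous (fun q => cut (H q / s) * (arctan ((U q - c) / M) * (-(k * fτ τ (U q))))) := by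
      refine cutmul_cont hH.continuous hs cut_contDiff.continuous (fun t ht => cut_zero ht.le) ?_
      exact (continuous_arctan.comp_continuousOn ((hU.continuousOn.sub continuousOn_const).div_const M)).mul
        (continuousOn_const.mul ((f_cont hτ).comp_continuousOn hU.continuousOn)).neg
    exact this.continuousOn.integrableOn_compact hDc
  have hC1' : 0 ≤ C1 := (abs_nonneg _).trans (first 0 1)
  have hCτ := Cτ_pos hτ
  have hi : ∫ q in D, cut (H q / s) * (k * |fτ τ (U q)|) ≤ C1 + 1 := by
    set v := volume.real D with hv
    have hv0 : 0 ≤ v := measureReal_nonneg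
    set M := (k * (Cτ τ * v + 1))⁻¹ with hMdef
    have hM : 0 < M := by positivity
    have hid := energy_id hH hU hL pH1 pH2 pU1 pU2 hs 0 hM
    rw [e3] at hid
    have h1 := first 0 M
    have h2 : 0 ≤ ∫ q in D, cut (H q / s) * (M / (M ^ 2 + (U q - 0) ^ 2) * (dX U q ^ 2 + dY U q ^ 2)) :=
      integral_nonneg fun q => mul_nonneg (cut_nonneg _) (by positivity)
    have h3 : ∫ q in D, (π / 2) * (cut (H q / s) * (k * |fτ τ (U q)|)) ≤
        ∫ q in D, (cut (H q / s) * (arctan ((U q - 0) / M) * (-(k * fτ τ (U q)))) + k * (Cτ τ * M)) := by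
      refine integral_mono (intf.const_mul _) ((c3 0 M).add (continuousOn_const.integrableOn_compact hDc)) ?_
      intro q
      simp only [sub_zero]
      have a1 := f_arctan hτ hM (U q)
      have a2 := cut_nonneg (H q / s)
      have a3 := cut_le_one (H q / s)
      have a4 : 0 ≤ k * (Cτ τ * M) := by positivity
      have a5 := mul_le_mul_of_nonneg_left a1 (mul_nonneg a2 hk.le)
      have a6 := mul_le_mul_of_nonneg_right a3 a4
      nlinarith
    rw [integral_const_mul, integral_add (c3 0 M) (continuousOn_const.integrableOn_compact hDc), setIntegral_const, smul_eq_mul] at h3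
    have h4 : v * (k * (Cτ τ * M)) ≤ 1 := by
      rw [hMdef]
      have : v * (k * (Cτ τ * (k * (Cτ τ * v + 1))⁻¹)) = (Cτ τ * v) / (Cτ τ * v + 1) := by
        have : Cτ τ * v + 1 ≠ 0 := by positivity
        field_simp
      rw [this, div_le_one (by positivity)]; linarith
    have h5 : 0 ≤ ∫ q in D, cut (H q / s) * (k * |fτ τ (U q)|) :=
      integral_nonneg fun q => mul_nonneg (cut_nonneg _) (by positivity)
    have h6 : 1 ≤ π / 2 := by linarith [pi_gt_three]
    have h7 := abs_le.1 h1
    nlinarith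
  have hid := energy_id hH hU hL pH1 pH2 pU1 pU2 hs c hM
  rw [e3] at hid
  have h1 := abs_le.1 (first c M)
  have h3 : |∫ q in D, cut (H q / s) * (arctan ((U q - c) / M) * (-(k * fτ τ (U q))))| ≤
      π / 2 * (C1 + 1) := by
    have : ‖∫ q in D, cut (H q / s) * (arctan ((U q - c) / M) * (-(k * fτ τ (U q))))‖ ≤
      ∫ q in D, (π / 2) * (cut (H q / s) * (k * |fτ τ (U q)|)) := by
      apply norm_integral_le_of_norm_le (intf.const_mul _)
      refine ae_of_all _ fun q => ?_
      rw [Real.norm_eq_abs, abs_mul, abs_mul, abs_neg, abs_mul, abs_of_nonneg (cut_nonneg _), abs_of_pos hk]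
      have := mul_le_mul_of_nonneg_right (abs_arctan_le ((U q - c) / M)) (mul_nonneg (cut_nonneg (H q / s)) (mul_nonneg hk.le (abs_nonneg (fτ τ (U q)))))
      linarith
    rw [integral_const_mul] at this
    refine this.trans ?_
    gcongr
  have h4 := abs_le.1 h3
  have h5 : ∫ q in Q, M / (M ^ 2 + (U q - c) ^ 2) * (dX U q ^ 2 + dY U q ^ 2) =
      ∫ q in Q, cut (H q / s) * (M / (M ^ 2 + (U q - c) ^ 2) * (dX U q ^ 2 + dY U q ^ 2)) := by
    refine setIntegral_congr_fun hQm fun q hq => ?_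
    rw [cut_one, one_mul]
    rw [le_div_iff₀ hs]; exact hQs q hq
  have h6 : ∫ q in Q, cut (H q / s) * (M / (M ^ 2 + (U q - c) ^ 2) * (dX U q ^ 2 + dY U q ^ 2)) ≤
      ∫ q in D, cut (H q / s) * (M / (M ^ 2 + (U q - c) ^ 2) * (dX U q ^ 2 + dY U q ^ 2)) := by
    apply setIntegral_mono_set
    · exact (cE c hM).continuousOn.integrableOn_compact hDc
    · exact ae_of_all _ fun q => mul_nonneg (cut_nonneg _) (by positivity)
    · exact hQD.eventuallyLE
  rw [h5]
  linarith

def eL : (ℝ × ℝ) →L[ℝ] Pl :=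
  (ContinuousLinearMap.fst ℝ ℝ ℝ).smulRight (EuclideanSpace.single 0 (1:ℝ)) +
  (ContinuousLinearMap.snd ℝ ℝ ℝ).smulRight (EuclideanSpace.single 1 (1:ℝ))

lemma eL_apply (q : ℝ × ℝ) : eL q = q.1 • EuclideanSpace.single 0 (1:ℝ) +
    q.2 • EuclideanSpace.single 1 (1:ℝ) := rfl
@[simp] lemma eL_zero (q : ℝ × ℝ) : eL q 0 = q.1 := by simp [eL_apply]
@[simp] lemma eL_one (q : ℝ × ℝ) : eL q 1 = q.2 := by simp [eL_apply]
lemma eL_surj (x : Pl) : eL (x 0, x 1) = x := by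
  ext i; fin_cases i <;> simp
lemma eL_inj {p q : ℝ × ℝ} (h : eL p = eL q) : p = q := by
  ext
  · rw [← eL_zero p, h, eL_zero]
  · rw [← eL_one p, h, eL_one]
lemma eL_norm (q : ℝ × ℝ) : ‖eL q‖ = √(q.1 ^ 2 + q.2 ^ 2) := by
  rw [EuclideanSpace.norm_eq]; simp [Fin.sum_univ_two]
lemma mem_lat (v : Pl) : v ∈ unitLattice ↔ ∃ a b : ℤ, v = eL (a, b) := Iff.rfl

def qf (P : Pl) (q : ℝ × ℝ) : ℝ := sin (π * (q.1 - P 0)) ^ 2 + sin (π * (q.2 - P 1)) ^ 2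

lemma qf_nonneg (P : Pl) (q : ℝ × ℝ) : 0 ≤ qf P q := by unfold qf; positivity
lemma qf_contDiff (P : Pl) : ContDiff ℝ 2 (qf P) := by
  unfold qf; fun_prop

lemma sin_int (y : ℝ) (a : ℤ) : sin (π * (y + a)) ^ 2 = sin (π * y) ^ 2 := by
  rw [mul_add, mul_comm π (a : ℝ), Real.sin_add_int_mul_pi]
  rw [mul_pow]
  have : ((-1 : ℝ) ^ a) ^ 2 = 1 := by
    rw [← zpow_natCast, ← zpow_mul, mul_comm, zpow_mul]; norm_num
  rw [this, one_mul]

lemma qf_add (P : Pl) (q : ℝ × ℝ) (a b : ℤ) : qf P (q + ((a : ℝ), (b : ℝ))) = qf P q := by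
  unfold qf
  rw [← sin_int (q.1 - P 0) a, ← sin_int (q.2 - P 1) b]
  simp only [Prod.fst_add, Prod.snd_add]
  ring_nf

lemma qf_zero {P : Pl} {q : ℝ × ℝ} : qf P q = 0 ↔ ∃ v ∈ unitLattice, eL q = P + v := by
  constructor
  · intro h
    unfold qf at h
    have h1 : sin (π * (q.1 - P 0)) = 0 := by nlinarith [sq_nonneg (sin (π * (q.1 - P 0))), sq_nonneg (sin (π * (q.2 - P 1)))]
    have h2 : sin (π * (q.2 - P 1)) = 0 := by nlinarith [sq_nonneg (sin (π * (q.1 - P 0))), sq_nonneg (sin (π * (q.2 - P 1)))]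
    obtain ⟨a, ha⟩ := Real.sin_eq_zero_iff.1 h1
    obtain ⟨b, hb⟩ := Real.sin_eq_zero_iff.1 h2
    have hp := pi_ne_zero
    have ha' : (a : ℝ) = q.1 - P 0 := by
      apply mul_left_cancel₀ hp; linarith
    have hb' : (b : ℝ) = q.2 - P 1 := by
      apply mul_left_cancel₀ hp; linarith
    refine ⟨eL (a, b), ⟨a, b, rfl⟩, ?_⟩
    ext i; fin_cases i <;> simp [ha', hb']
  · rintro ⟨v, ⟨a, b, rfl⟩, h⟩
    have h0 : q.1 = P 0 + a := by rw [← eL_zero q, h]; simp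
    have h1 : q.2 = P 1 + b := by rw [← eL_one q, h]; simp
    have e : q = (P 0, P 1) + ((a : ℝ), (b : ℝ)) := by ext <;> simp [h0, h1]
    rw [e, qf_add]; simp [qf]

lemma qf_lower {P : Pl} {p0 : ℝ × ℝ} (h0 : qf P p0 = 0) {q : ℝ × ℝ} (hq : ‖q - p0‖ ≤ 1 / 2) :
    ‖q - p0‖ ^ 2 ≤ qf P q := by
  obtain ⟨v, ⟨a, b, rfl⟩, h⟩ := qf_zero.1 h0
  have h0 : p0.1 = P 0 + a := by rw [← eL_zero p0, h]; simp
  have h1 : p0.2 = P 1 + b := by rw [← eL_one p0, h]; simp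
  have key : ∀ y : ℝ, |y| ≤ 1 / 2 → y ^ 2 ≤ sin (π * y) ^ 2 := by
    intro y hy
    have hpp := pi_pos
    have := Real.mul_abs_le_abs_sin (x := π * y) (by rw [abs_mul, abs_of_pos hpp]; nlinarith)
    rw [abs_mul, abs_of_pos hpp] at this
    have e : 2 / π * (π * |y|) = 2 * |y| := by field_simp
    rw [e] at this
    apply sq_le_sq.2
    linarith [abs_nonneg y]
  rw [Prod.norm_def] at hq ⊢
  simp only [Prod.fst_sub, Prod.snd_sub, Real.norm_eq_abs] at hq ⊢
  have k1 := key _ ((le_max_left _ _).trans hq)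
  have k2 := key _ ((le_max_right _ _).trans hq)
  unfold qf
  rw [← sin_int _ a] at k1
  rw [← sin_int _ b] at k2
  rw [show q.1 - p0.1 + a = q.1 - P 0 by rw [h0]; ring] at k1
  rw [show q.2 - p0.2 + b = q.2 - P 1 by rw [h1]; ring] at k2
  rcases max_cases |q.1 - p0.1| |q.2 - p0.2| with ⟨h, _⟩ | ⟨h, _⟩ <;> rw [h, sq_abs] <;>
    nlinarith [sq_nonneg (sin (π * (q.1 - P 0))), sq_nonneg (sin (π * (q.2 - P 1)))]

def VortexData.pt (V : VortexData) : Fin V.d₁ ⊕ Fin V.d₂ → Pl := Sum.elim V.p₁ V.p₂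
def VortexData.mu (V : VortexData) : Fin V.d₁ ⊕ Fin V.d₂ → ℝ := Sum.elim V.m₁ (fun j => -V.m₂ j)

def HH (V : VortexData) (q : ℝ × ℝ) : ℝ := ∏ j, qf (V.pt j) q

lemma HH_nonneg (V : VortexData) (q) : 0 ≤ HH V q := Finset.prod_nonneg fun j _ => qf_nonneg _ _
lemma HH_contDiff (V : VortexData) : ContDiff ℝ 2 (HH V) := by
  unfold HH
  exact contDiff_prod fun j _ => qf_contDiff _
lemma HH_add (V : VortexData) (q : ℝ × ℝ) (a b : ℤ) : HH V (q + ((a : ℝ), (b : ℝ))) = HH V q := by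
  unfold HH; simp only [qf_add]
lemma HH_zero {V : VortexData} {q : ℝ × ℝ} : HH V q = 0 ↔ ∃ j, ∃ v ∈ unitLattice, eL q = V.pt j + v := by
  unfold HH
  rw [Finset.prod_eq_zero_iff]
  simp only [Finset.mem_univ, true_and, qf_zero]
lemma HH_zero' {V : VortexData} {q : ℝ × ℝ} : HH V q = 0 ↔ eL q ∈ V.Z := by
  rw [HH_zero]
  constructor
  · rintro ⟨j | j, v, hv, h⟩
    · exact Or.inl ⟨j, v, hv, h⟩
    · exact Or.inr ⟨j, v, hv, h⟩
  · rintro (⟨j, v, hv, h⟩ | ⟨j, v, hv, h⟩)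
    · exact ⟨Sum.inl j, v, hv, h⟩
    · exact ⟨Sum.inr j, v, hv, h⟩

lemma HH_lower {V : VortexData} {p0 : ℝ × ℝ} (h0 : HH V p0 = 0) :
    ∃ c > 0, ∀ᶠ q in 𝓝 p0, c * ‖q - p0‖ ^ 2 ≤ HH V q := by
  classical
  obtain ⟨j, hj⟩ := HH_zero.1 h0
  have hq := qf_zero.2 hj
  set R : ℝ × ℝ → ℝ := fun q => ∏ k ∈ Finset.univ.erase j, qf (V.pt k) q with hR
  have hRc : Continuous R := continuous_finset_prod _ fun k _ => (qf_contDiff _).continuous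
  have hRp : 0 < R p0 := by
    apply Finset.prod_pos
    intro k hk
    refine lt_of_le_of_ne (qf_nonneg _ _) (Ne.symm ?_)
    intro hk0
    obtain ⟨v, ⟨a, b, rfl⟩, h⟩ := qf_zero.1 hk0
    obtain ⟨w, ⟨a', b', rfl⟩, h'⟩ := hj
    have h2 : V.pt k + eL ((a : ℝ), (b : ℝ)) = V.pt j + eL ((a' : ℝ), (b' : ℝ)) := by
      exact h.symm.trans h'
    have h3 : eL (((a' - a : ℤ) : ℝ), ((b' - b : ℤ) : ℝ)) = eL ((a' : ℝ), (b' : ℝ)) - eL ((a : ℝ), (b : ℝ)) := by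
      rw [← map_sub, Prod.mk_sub_mk, Int.cast_sub, Int.cast_sub]
    have h4 : V.pt k = V.pt j + eL (((a' - a : ℤ) : ℝ), ((b' - b : ℤ) : ℝ)) := by
      rw [h3, ← add_sub_assoc]; exact eq_sub_of_add_eq h2
    exact V.distinct k j (Finset.ne_of_mem_erase hk) _ ⟨_, _, rfl⟩ h4
  refine ⟨R p0 / 2, half_pos hRp, ?_⟩
  have e1 : ∀ᶠ q in 𝓝 p0, R p0 / 2 < R q :=
    continuousAt_const.eventually_lt hRc.continuousAt (half_lt_self hRp)
  have e2 : ∀ᶠ q in 𝓝 p0, ‖q - p0‖ < 1 / 2 := by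
    have : ContinuousAt (fun q : ℝ × ℝ => ‖q - p0‖) p0 := by fun_prop
    exact this.eventually_lt continuousAt_const (by simp)
  filter_upwards [e1, e2] with q h1 h2
  unfold HH
  rw [← Finset.mul_prod_erase _ _ (Finset.mem_univ j), mul_comm (qf _ _)]
  exact mul_le_mul h1.le (qf_lower hq h2.le) (by positivity) ((half_pos hRp).le.trans h1.le)

lemma vol_small (V : VortexData) (L : ℝ) :
    ∃ C, ∀ t > 0, volume.real (closedBall (0 : ℝ × ℝ) L ∩ {q | HH V q ≤ t}) ≤ C * t := by
  have hc := (HH_contDiff V).continuous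
  have key : ∃ C : ℝ, 0 ≤ C ∧ ∀ t > 0, volume (closedBall (0 : ℝ × ℝ) L ∩ {q | HH V q ≤ t}) ≤ ENNReal.ofReal (C * t) := by
    refine (isCompact_closedBall (0 : ℝ × ℝ) L).induction_on
      (p := fun S => ∃ C : ℝ, 0 ≤ C ∧ ∀ t > 0, volume (S ∩ {q | HH V q ≤ t}) ≤ ENNReal.ofReal (C * t)) ?_ ?_ ?_ ?_
    · exact ⟨0, le_rfl, by simp⟩
    · rintro S T hST ⟨C, h0, h⟩
      exact ⟨C, h0, fun t ht => (measure_mono (inter_subset_inter_left _ hST)).trans (h t ht)⟩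
    · rintro S T ⟨C, h0, h⟩ ⟨C', h0', h'⟩
      refine ⟨C + C', by positivity, fun t ht => ?_⟩
      rw [union_inter_distrib_right, add_mul, ENNReal.ofReal_add (by positivity) (by positivity)]
      exact (measure_union_le _ _).trans (add_le_add (h t ht) (h' t ht))
    · intro p _
      by_cases hp : HH V p = 0
      · obtain ⟨c, hc0, hev⟩ := HH_lower hp
        refine ⟨_, mem_nhdsWithin_of_mem_nhds hev, 4 / c, by positivity, fun t ht => ?_⟩
        have hsub : {q | c * ‖q - p‖ ^ 2 ≤ HH V q} ∩ {q | HH V q ≤ t} ⊆ closedBall p (√(t / c)) := by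
          rintro q ⟨h1, h2⟩
          simp only [mem_setOf_eq] at h1 h2
          rw [mem_closedBall, dist_eq_norm]
          apply Real.le_sqrt_of_sq_le
          rw [le_div_iff₀ hc0]; linarith
        refine (measure_mono hsub).trans ?_
        have h3 := vol_cb p (Real.sqrt_nonneg (t / c))
        rw [Real.sq_sqrt (by positivity)] at h3
        have h4 : volume (closedBall p √(t / c)) ≠ ⊤ := measure_closedBall_lt_top.ne
        rw [← ENNReal.ofReal_toReal h4]
        apply ENNReal.ofReal_le_ofReal
        change volume.real _ ≤ _
        rw [h3]; apply le_of_eq; ring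
      · have hpp : 0 < HH V p := lt_of_le_of_ne (HH_nonneg V p) (Ne.symm hp)
        have hev : ∀ᶠ q in 𝓝 p, HH V p / 2 < HH V q :=
          continuousAt_const.eventually_lt hc.continuousAt (half_lt_self hpp)
        have hb : ball p 1 ∈ 𝓝 p := ball_mem_nhds _ one_pos
        refine ⟨_, mem_nhdsWithin_of_mem_nhds (inter_mem hev hb), volume.real (ball p 1) / (HH V p / 2), div_nonneg measureReal_nonneg (half_pos hpp).le, fun t ht => ?_⟩
        rcases lt_or_ge t (HH V p / 2) with h | h
        · have : (({x | HH V p / 2 < HH V x} ∩ ball p 1) ∩ {q | HH V q ≤ t}) = ∅ := by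
            ext q
            simp only [mem_inter_iff, mem_setOf_eq, mem_empty_iff_false, iff_false]
            rintro ⟨⟨h1, _⟩, h2⟩
            linarith
          rw [this]; simp
        · refine (measure_mono (inter_subset_left.trans inter_subset_right)).trans ?_
          have h4 : volume (ball p 1) ≠ ⊤ := measure_ball_lt_top.ne
          rw [← ENNReal.ofReal_toReal h4]
          apply ENNReal.ofReal_le_ofReal
          change volume.real _ ≤ _
          rw [div_mul_eq_mul_div, le_div_iff₀ (half_pos hpp)]
          exact mul_le_mul_of_nonneg_left h measureReal_nonneg
  obtain ⟨C, h0, h⟩ := key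
  exact ⟨C, fun t ht => ENNReal.toReal_le_of_le_ofReal (by positivity) (h t ht)⟩

lemma grad_H (V : VortexData) (L : ℝ) : ∃ C, 0 ≤ C ∧ ∀ p0 ∈ closedBall (0 : ℝ × ℝ) L, HH V p0 = 0 →
    ∀ᶠ q in 𝓝 p0, |dX (HH V) q| ≤ C * ‖q - p0‖ ∧ |dY (HH V) q| ≤ C * ‖q - p0‖ := by
  have hH := HH_contDiff V
  have h1 : ContDiff ℝ 1 (fderiv ℝ (HH V)) := hH.fderiv_right (by norm_num)
  obtain ⟨C, hC⟩ := (isCompact_closedBall (0 : ℝ × ℝ) (L + 1)).exists_bound_of_continuousOn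
    (h1.continuous_fderiv (by norm_num)).continuousOn
  refine ⟨max C 0, le_max_right _ _, fun p0 hp0 hz => ?_⟩
  have hmin : IsLocalMin (HH V) p0 := Filter.Eventually.of_forall fun q => by rw [hz]; exact HH_nonneg V q
  have hd0 := hmin.fderiv_eq_zero
  have hp0' : dist p0 0 ≤ L := hp0
  filter_upwards [ball_mem_nhds p0 one_pos] with q hq
  have hq' : q ∈ closedBall (0 : ℝ × ℝ) (L + 1) := by
    rw [mem_closedBall]
    have := dist_triangle q p0 0
    rw [mem_ball] at hq
    linarith
  have key := (convex_closedBall (0 : ℝ × ℝ) (L + 1)).norm_image_sub_le_of_norm_fderiv_le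
    (f := fderiv ℝ (HH V)) (C := C) (x := p0) (y := q) (𝕜 := ℝ)
    (fun x _ => h1.differentiable (by norm_num) x) hC (by rw [mem_closedBall]; linarith) hq'
  rw [hd0, sub_zero] at key
  have k2 : ‖fderiv ℝ (HH V) q‖ ≤ max C 0 * ‖q - p0‖ := key.trans (by gcongr; exact le_max_left _ _)
  constructor
  · have := (fderiv ℝ (HH V) q).le_opNorm (1, 0)
    rw [Prod.norm_mk, norm_one, norm_zero, max_eq_left zero_le_one, mul_one] at this
    exact this.trans k2
  · have := (fderiv ℝ (HH V) q).le_opNorm (0, 1)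
    rw [Prod.norm_mk, norm_one, norm_zero, max_eq_right zero_le_one, mul_one] at this
    exact this.trans k2

lemma grad_sing {U w : ℝ × ℝ → ℝ} {a : ℝ} {p0 : ℝ × ℝ} (hw : ContDiffAt ℝ 1 w p0)
    (hU : ∀ᶠ q in 𝓝[≠] p0, U q = a * Real.log ((q.1 - p0.1) ^ 2 + (q.2 - p0.2) ^ 2) + w q) :
    ∀ᶠ q in 𝓝[≠] p0, |dX U q| ≤ (2 * |a| + 1) / ‖q - p0‖ ∧ |dY U q| ≤ (2 * |a| + 1) / ‖q - p0‖ := by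
  have hU' := eventually_eventually_nhdsWithin.2 hU
  have hwd : ∀ᶠ q in 𝓝 p0, ContDiffAt ℝ 1 w q := hw.eventually (by simp)
  set B := ‖fderiv ℝ w p0‖ + 1 with hB
  have hwb : ∀ᶠ q in 𝓝 p0, ‖fderiv ℝ w q‖ < B :=
    ((hw.fderiv_right (m := 0) (by norm_num)).continuousAt.norm).eventually_lt continuousAt_const (by linarith)
  have hn : ∀ᶠ q in 𝓝 p0, B * ‖q - p0‖ < 1 := by
    have : ContinuousAt (fun q : ℝ × ℝ => B * ‖q - p0‖) p0 := by fun_prop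
    exact this.eventually_lt continuousAt_const (by simp)
  filter_upwards [hU', nhdsWithin_le_nhds hwd, nhdsWithin_le_nhds hwb, nhdsWithin_le_nhds hn,
    self_mem_nhdsWithin] with q h1 h2 h3 h4 h5
  have hne : q ≠ p0 := h5
  rw [isOpen_compl_singleton.nhdsWithin_eq h5] at h1
  obtain ⟨x, y⟩ := q
  have hpos : 0 < ‖(x, y) - p0‖ := norm_pos_iff.2 (sub_ne_zero.2 hne)
  have hwd := h2.differentiableAt (by norm_num)
  set N := (x - p0.1) ^ 2 + (y - p0.2) ^ 2 with hN
  have hNle : ‖(x, y) - p0‖ ^ 2 ≤ N := by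
    rw [Prod.norm_def]
    simp only [Prod.fst_sub, Prod.snd_sub, Real.norm_eq_abs]
    rcases max_cases |x - p0.1| |y - p0.2| with ⟨h, _⟩ | ⟨h, _⟩ <;> rw [h, sq_abs] <;>
    nlinarith [sq_nonneg (x - p0.1), sq_nonneg (y - p0.2)]
  have hNpos : 0 < N := lt_of_lt_of_le (by positivity) hNle
  have hx1 : |x - p0.1| ≤ ‖(x, y) - p0‖ := norm_fst_le ((x, y) - p0)
  have hy1 : |y - p0.2| ≤ ‖(x, y) - p0‖ := norm_snd_le ((x, y) - p0)
  set r := ‖(x, y) - p0‖ with hr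
  have hfin : ∀ d m : ℝ, |d| ≤ r → |m| ≤ B → |a * (2 * d / N) + m| ≤ (2 * |a| + 1) / r := by
    intro d m hd hm
    have e1 : |d| / N ≤ 1 / r := by
      rw [div_le_div_iff₀ hNpos hpos]; nlinarith
    have e2 : B ≤ 1 / r := by rw [le_div_iff₀ hpos]; exact h4.le
    calc _ ≤ |a * (2 * d / N)| + |m| := abs_add_le _ _
      _ = 2 * |a| * (|d| / N) + |m| := by
        rw [abs_mul, abs_div, abs_mul, abs_two, abs_of_pos hNpos]; ring
      _ ≤ 2 * |a| * (1 / r) + 1 / r := by gcongr; exact hm.trans e2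
      _ = _ := by ring
  have hdl : DifferentiableAt ℝ (fun q : ℝ × ℝ => a * Real.log ((q.1 - p0.1) ^ 2 + (q.2 - p0.2) ^ 2) + w q) (x, y) := by
    have d1 : DifferentiableAt ℝ (fun q : ℝ × ℝ => (q.1 - p0.1) ^ 2 + (q.2 - p0.2) ^ 2) (x, y) := by fun_prop
    have d2 := d1.log (show (fun q : ℝ × ℝ => (q.1 - p0.1) ^ 2 + (q.2 - p0.2) ^ 2) (x, y) ≠ 0 from hNpos.ne')
    exact (d2.const_mul a).add hwd
  have hdU : DifferentiableAt ℝ U (x, y) := hdl.congr_of_eventuallyEq h1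
  have l1 : HasDerivAt (fun t : ℝ => (t, y)) ((1 : ℝ), (0 : ℝ)) x :=
    (hasDerivAt_id x).prodMk (hasDerivAt_const x y)
  have l2 : HasDerivAt (fun t : ℝ => (x, t)) ((0 : ℝ), (1 : ℝ)) y :=
    (hasDerivAt_const y x).prodMk (hasDerivAt_id y)
  have hwX : |dX w (x, y)| ≤ B := by
    have := (fderiv ℝ w (x, y)).le_opNorm (1, 0)
    rw [Prod.norm_mk, norm_one, norm_zero, max_eq_left zero_le_one, mul_one] at this
    exact this.trans h3.le
  have hwY : |dY w (x, y)| ≤ B := by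
    have := (fderiv ℝ w (x, y)).le_opNorm (0, 1)
    rw [Prod.norm_mk, norm_one, norm_zero, max_eq_right zero_le_one, mul_one] at this
    exact this.trans h3.le
  have h1' : U =ᶠ[𝓝 (x, y)] fun q : ℝ × ℝ => a * Real.log ((q.1 - p0.1) ^ 2 + (q.2 - p0.2) ^ 2) + w q := h1
  constructor
  · have hd : dX U (x, y) = a * (2 * (x - p0.1) / N) + dX w (x, y) := by
      unfold dX
      rw [h1'.fderiv_eq]
      refine dX_unique hdl (d := a * (2 * (x - p0.1) / N) + dX w (x, y)) ?_
      have hw1 : HasDerivAt (fun t => w (t, y)) (dX w (x, y)) x := by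
        have := hwd.hasFDerivAt.comp_hasDerivAt x l1
        exact this
      have hp : HasDerivAt (fun t : ℝ => (t - p0.1) ^ 2 + (y - p0.2) ^ 2) (2 * (x - p0.1)) x := by
        have := (((hasDerivAt_id x).sub_const p0.1).pow 2).add_const ((y - p0.2) ^ 2)
        simpa using this
      exact ((hp.log hNpos.ne').const_mul a).add hw1
    rw [hd]; exact hfin _ _ hx1 hwX
  · have hd : dY U (x, y) = a * (2 * (y - p0.2) / N) + dY w (x, y) := by
      unfold dY
      rw [h1'.fderiv_eq]
      refine dY_unique hdl (d := a * (2 * (y - p0.2) / N) + dY w (x, y)) ?_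
      have hw1 : HasDerivAt (fun t => w (x, t)) (dY w (x, y)) y := by
        have := hwd.hasFDerivAt.comp_hasDerivAt y l2
        exact this
      have hp : HasDerivAt (fun t : ℝ => (x - p0.1) ^ 2 + (t - p0.2) ^ 2) (2 * (y - p0.2)) y := by
        have := (((hasDerivAt_id y).sub_const p0.2).pow 2).const_add ((x - p0.1) ^ 2)
        simpa using this
      exact ((hp.log hNpos.ne').const_mul a).add hw1
    rw [hd]; exact hfin _ _ hy1 hwY

def UU (u : Pl → ℝ) (q : ℝ × ℝ) : ℝ := u (eL q)

lemma UU_add {u : Pl → ℝ} (h : Periodic2 u) (q : ℝ × ℝ) (a b : ℤ) : UU u (q + ((a : ℝ), (b : ℝ))) = UU u q := by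
  unfold UU
  rw [map_add]
  exact h _ _ ⟨a, b, rfl⟩

lemma HH_isOpen (V : VortexData) : IsOpen {q | HH V q ≠ 0} :=
  isOpen_ne_fun (HH_contDiff V).continuous continuous_const

lemma UU_contDiffOn {V : VortexData} {τ ε : ℝ} {u : Pl → ℝ} (hu : IsSolution V τ ε u) :
    ContDiffOn ℝ 2 (UU u) {q | HH V q ≠ 0} := by
  have h1 : ContDiffOn ℝ 2 u (V.Z)ᶜ := hu.smooth.of_le (show ((2 : ℕ∞) : WithTop ℕ∞) ≤ _ from WithTop.coe_le_coe.2 le_top)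
  refine h1.comp eL.contDiff.contDiffOn ?_
  intro q hq hz
  exact hq (HH_zero'.2 hz)

lemma pd_zero (u : Pl → ℝ) (p : ℝ × ℝ) : pd u 0 (eL p) = lineDeriv ℝ (UU u) p (1, 0) := by
  unfold pd lineDeriv UU
  have : ∀ t : ℝ, eL (p + t • ((1 : ℝ), (0 : ℝ))) = eL p + t • EuclideanSpace.single 0 (1 : ℝ) := by
    intro t
    rw [map_add, map_smul]; congr 2; rw [eL_apply]; simp
  simp only [this]

lemma pd_one (u : Pl → ℝ) (p : ℝ × ℝ) : pd u 1 (eL p) = lineDeriv ℝ (UU u) p (0, 1) := by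
  unfold pd lineDeriv UU
  have : ∀ t : ℝ, eL (p + t • ((0 : ℝ), (1 : ℝ))) = eL p + t • EuclideanSpace.single 1 (1 : ℝ) := by
    intro t
    rw [map_add, map_smul]; congr 2; rw [eL_apply]; simp
  simp only [this]

lemma lap_eq {V : VortexData} {τ ε : ℝ} {u : Pl → ℝ} (hu : IsSolution V τ ε u) {p : ℝ × ℝ}
    (hp : HH V p ≠ 0) : lap u (eL p) = lapR (UU u) p := by
  have hU := UU_contDiffOn hu
  have ho := HH_isOpen V
  have hd : ∀ q, HH V q ≠ 0 → DifferentiableAt ℝ (UU u) q := fun q hq =>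
    (hU.contDiffAt (ho.mem_nhds hq)).differentiableAt (by norm_num)
  have e1 : UU (pd u 0) =ᶠ[𝓝 p] dX (UU u) := by
    filter_upwards [ho.mem_nhds hp] with q hq
    exact (pd_zero u q).trans (hd q hq).lineDeriv_eq_fderiv
  have e2 : UU (pd u 1) =ᶠ[𝓝 p] dY (UU u) := by
    filter_upwards [ho.mem_nhds hp] with q hq
    exact (pd_one u q).trans (hd q hq).lineDeriv_eq_fderiv
  unfold lap lapR
  rw [pd_zero, pd_one, e1.lineDeriv_eq, e2.lineDeriv_eq]
  have d1 : DifferentiableAt ℝ (dX (UU u)) p :=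
    ((dX_contDiffOn ho hU).contDiffAt (ho.mem_nhds hp)).differentiableAt (by norm_num)
  have d2 : DifferentiableAt ℝ (dY (UU u)) p :=
    ((dY_contDiffOn ho hU).contDiffAt (ho.mem_nhds hp)).differentiableAt (by norm_num)
  rw [d1.lineDeriv_eq_fderiv, d2.lineDeriv_eq_fderiv]
  rfl

lemma lap_sol {V : VortexData} {τ ε : ℝ} {u : Pl → ℝ} (hu : IsSolution V τ ε u) {p : ℝ × ℝ}
    (hp : HH V p ≠ 0) : lapR (UU u) p = -((ε ^ 2)⁻¹ * fτ τ (UU u p)) := by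
  have h1 := hu.pde (eL p) (fun h => hp (HH_zero'.2 h))
  rw [lap_eq hu hp] at h1
  exact eq_neg_of_add_eq_zero_left h1

lemma sol_grad {V : VortexData} {τ ε : ℝ} {u : Pl → ℝ} (hu : IsSolution V τ ε u) {p0 : ℝ × ℝ}
    (hp : HH V p0 = 0) : ∀ᶠ q in 𝓝[≠] p0,
      |dX (UU u) q| ≤ (2 * (∑ j, |V.mu j|) + 1) / ‖q - p0‖ ∧
      |dY (UU u) q| ≤ (2 * (∑ j, |V.mu j|) + 1) / ‖q - p0‖ := by
  obtain ⟨j, v, hv, hj⟩ := HH_zero.1 hp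
  have hs : LogSing u (V.pt j) (V.mu j) := by
    rcases j with j | j
    · exact hu.sing₁ j
    · exact hu.sing₂ j
  obtain ⟨r, hr, w, hw, hrep⟩ := hs
  have hpj : eL p0 - v = V.pt j := by rw [hj]; simp
  have hcw : ContDiffAt ℝ 1 (fun q => w (eL q - v)) p0 := by
    have h1 : ContDiffAt ℝ 1 w (eL p0 - v) := by
      rw [hpj]
      exact (hw.contDiffAt (ball_mem_nhds _ hr)).of_le (by exact_mod_cast le_top)
    exact h1.comp p0 (eL.contDiff.sub contDiff_const).contDiffAt
  have hle : |V.mu j| ≤ ∑ j, |V.mu j| :=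
    Finset.single_le_sum (f := fun j => |V.mu j|) (fun i _ => abs_nonneg _) (Finset.mem_univ j)
  have hnear : ∀ᶠ q in 𝓝 p0, eL q - v ∈ ball (V.pt j) r := by
    have hc : ContinuousAt (fun q => eL q - v) p0 := (eL.continuous.sub continuous_const).continuousAt
    exact hc.preimage_mem_nhds (by rw [hpj]; exact ball_mem_nhds _ hr)
  have key := grad_sing (U := UU u) (a := V.mu j) hcw ?_
  · filter_upwards [key, self_mem_nhdsWithin] with q h1 h2
    have hb : (2 * |V.mu j| + 1) / ‖q - p0‖ ≤ (2 * (∑ j, |V.mu j|) + 1) / ‖q - p0‖ := by gcongr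
    exact ⟨h1.1.trans hb, h1.2.trans hb⟩
  · filter_upwards [nhdsWithin_le_nhds hnear, self_mem_nhdsWithin] with q h1 h2
    have hne : eL q - v ≠ V.pt j := by
      intro h
      rw [← hpj] at h
      exact h2 (eL_inj (sub_left_injective h))
    have h3 := hrep _ h1 hne
    have h4 : u (eL q - v) = UU u q := by
      have := hu.periodic (eL q - v) v hv
      rw [sub_add_cancel] at this
      exact this.symm
    rw [h4, ← hpj, sub_sub_sub_cancel_right, ← map_sub, eL_norm, Real.log_sqrt (by positivity)] at h3
    rw [h3]
    simp only [Prod.fst_sub, Prod.snd_sub]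
    ring

lemma grad_prod (V : VortexData) (L : ℝ) : ∃ M0, 0 ≤ M0 ∧ ∀ (τ ε : ℝ) (u : Pl → ℝ), IsSolution V τ ε u →
    ∃ s0 > 0, ∀ q ∈ closedBall (0 : ℝ × ℝ) L, 0 < HH V q → HH V q < s0 →
      |dX (HH V) q * dX (UU u) q + dY (HH V) q * dY (UU u) q| ≤ M0 := by
  obtain ⟨C, hC0, hC⟩ := grad_H V L
  set B := 2 * (∑ j, |V.mu j|) + 1 with hB
  have hB0 : 0 ≤ B := by
    have : 0 ≤ ∑ j, |V.mu j| := Finset.sum_nonneg fun i _ => abs_nonneg _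
    linarith
  refine ⟨2 * (C * B), by positivity, fun τ ε u hu => ?_⟩
  refine (isCompact_closedBall (0 : ℝ × ℝ) L).induction_on
    (p := fun S => ∃ s0 > 0, ∀ q ∈ S, 0 < HH V q → HH V q < s0 →
      |dX (HH V) q * dX (UU u) q + dY (HH V) q * dY (UU u) q| ≤ 2 * (C * B)) ?_ ?_ ?_ ?_
  · exact ⟨1, one_pos, by simp⟩
  · rintro S T hST ⟨s, hs, h⟩
    exact ⟨s, hs, fun q hq => h q (hST hq)⟩
  · rintro S T ⟨s, hs, h⟩ ⟨s', hs', h'⟩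
    refine ⟨min s s', lt_min hs hs', fun q hq h0 hlt => ?_⟩
    rcases hq with hq | hq
    · exact h q hq h0 (hlt.trans_le (min_le_left _ _))
    · exact h' q hq h0 (hlt.trans_le (min_le_right _ _))
  · intro p hpD
    by_cases hp : HH V p = 0
    · have hev : ∀ᶠ q in 𝓝[≠] p, |dX (HH V) q * dX (UU u) q + dY (HH V) q * dY (UU u) q| ≤ 2 * (C * B) := by
        filter_upwards [sol_grad hu hp, nhdsWithin_le_nhds (hC p hpD hp), self_mem_nhdsWithin] with q h1 h2 h3
        have hpos : 0 < ‖q - p‖ := norm_pos_iff.2 (sub_ne_zero.2 h3)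
        have e : C * ‖q - p‖ * (B / ‖q - p‖) = C * B := by field_simp
        have t1 : |dX (HH V) q * dX (UU u) q| ≤ C * B := by
          rw [abs_mul, ← e]; exact mul_le_mul h2.1 h1.1 (abs_nonneg _) (by positivity)
        have t2 : |dY (HH V) q * dY (UU u) q| ≤ C * B := by
          rw [abs_mul, ← e]; exact mul_le_mul h2.2 h1.2 (abs_nonneg _) (by positivity)
        have := abs_add_le (dX (HH V) q * dX (UU u) q) (dY (HH V) q * dY (UU u) q)
        linarith
      rw [eventually_nhdsWithin_iff] at hev
      refine ⟨_, mem_nhdsWithin_of_mem_nhds hev, 1, one_pos, fun q hq h0 _ => hq ?_⟩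
      intro h
      rw [mem_singleton_iff] at h
      rw [h, hp] at h0
      exact lt_irrefl _ h0
    · have hpp : 0 < HH V p := lt_of_le_of_ne (HH_nonneg V p) (Ne.symm hp)
      have hev : ∀ᶠ q in 𝓝 p, HH V p / 2 < HH V q :=
          continuousAt_const.eventually_lt (HH_contDiff V).continuous.continuousAt (half_lt_self hpp)
      refine ⟨_, mem_nhdsWithin_of_mem_nhds hev, HH V p / 2, half_pos hpp, fun q hq _ h1 => ?_⟩
      exact absurd h1 (not_lt.2 (le_of_lt hq))

lemma local_final (V : VortexData) {τ : ℝ} (hτ : 0 < τ) {K : Set Pl} (hK : IsCompact K) (hKZ : K ⊆ (V.Z)ᶜ) :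
    ∃ δ > 0, ∃ b0 ≥ 0, ∀ (ε : ℝ) (u : Pl → ℝ), 0 < ε → IsSolution V τ ε u →
      ∀ x ∈ K, ∀ z, ∀ ρ > 0, ρ ≤ δ → dist z x ≤ ρ →
        |u x - u z| ≤ 4 * ((ε ^ 2)⁻¹ * Cτ τ) * ρ ^ 2 + b0 := by
  have hcl : Continuous fun x : Pl => (x 0, x 1) := by fun_prop
  set K' : Set (ℝ × ℝ) := (fun x : Pl => (x 0, x 1)) '' K with hK'
  have hK'c : IsCompact K' := hK.image hcl
  have ho := HH_isOpen V
  have hK'W : K' ⊆ {q | HH V q ≠ 0} := by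
    rintro _ ⟨x, hx, rfl⟩ h
    have := HH_zero'.1 h
    rw [eL_surj] at this
    exact hKZ hx this
  obtain ⟨δ, hδ, hsub⟩ := hK'c.exists_cthickening_subset_open ho hK'W
  set T := cthickening δ K' with hT
  have hTc : IsCompact T := hK'c.cthickening
  obtain ⟨R, hR⟩ := hTc.isBounded.subset_closedBall (0 : ℝ × ℝ)
  set L : ℕ := ⌈R⌉₊ with hL
  have hTL : T ⊆ closedBall (0 : ℝ × ℝ) L := hR.trans (closedBall_subset_closedBall (Nat.le_ceil R))
  obtain ⟨h0, hh0, hT0⟩ := hTc.exists_forall_le' (HH_contDiff V).continuous.continuousOn (a := 0)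
    (fun q hq => lt_of_le_of_ne (HH_nonneg V q) (Ne.symm (hsub hq)))
  obtain ⟨CH, hCH⟩ := vol_small V L
  obtain ⟨M0, hM0, hG⟩ := grad_prod V L
  obtain ⟨Cφ, hCφ0, hCφ⟩ := dcut_bound
  set C0 := π / 2 * (Cφ * M0 * π * CH + 1) + Cφ * M0 * π * CH with hC0
  refine ⟨δ / 3, by positivity, 2 * (36 + 5476 * C0 ^ 2), by positivity, ?_⟩
  intro ε u hε hu x hx z ρ hρ hρδ hz
  obtain ⟨s0, hs0, hg⟩ := hG τ ε u hu
  set s := min (s0 / 4) (h0 / 2) with hs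
  have hspos : 0 < s := lt_min (by positivity) (by positivity)
  have hs1 : s ≤ s0 / 4 := min_le_left _ _
  have hs2 : s ≤ h0 / 2 := min_le_right _ _
  set p : ℝ × ℝ := (x 0, x 1) with hp
  have hpK : p ∈ K' := ⟨x, hx, rfl⟩
  have hQT : closedBall p (3 * ρ) ⊆ T :=
    (closedBall_subset_closedBall (by linarith)).trans (closedBall_subset_cthickening hpK δ)
  have hU := UU_contDiffOn hu
  have hzp : ((z 0, z 1) : ℝ × ℝ) ∈ closedBall p ρ := by
    have k : ∀ i : Fin 2, dist (z i) (x i) ≤ ρ := fun i => by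
      refine le_trans ?_ hz
      rw [dist_eq_norm, dist_eq_norm]
      exact PiLp.norm_apply_le (z - x) i
    rw [mem_closedBall, Prod.dist_eq]
    exact max_le (k 0) (k 1)
  have hA : ∀ q ∈ {q | HH V q ≠ 0}, |lapR (UU u) q| ≤ (ε ^ 2)⁻¹ * Cτ τ := by
    intro q hq
    rw [lap_sol hu hq, abs_neg, abs_mul, abs_of_pos (by positivity : 0 < (ε ^ 2)⁻¹)]
    gcongr
    exact f_bound hτ _
  have pp : ∀ {F : ℝ × ℝ → ℝ}, (∀ q (a b : ℤ), F (q + ((a : ℝ), (b : ℝ))) = F q) →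
      (∀ q, F (q + (2 * (L : ℝ), 0)) = F q) ∧ (∀ q, F (q + (0, 2 * (L : ℝ))) = F q) := by
    intro F hF
    constructor
    · intro q
      have := hF q (2 * L : ℤ) 0
      push_cast at this; exact this
    · intro q
      have := hF q 0 (2 * L : ℤ)
      push_cast at this; exact this
  have hE : ∀ c M : ℝ, 0 < M → ∫ q in closedBall p (3 * ρ),
      M / (M ^ 2 + (UU u q - c) ^ 2) * (dX (UU u) q ^ 2 + dY (UU u) q ^ 2) ≤ C0 := by
    intro c M hM
    exact energy_final (HH_contDiff V) hU (HH_nonneg V) (Nat.cast_nonneg L) (pp (HH_add V)).1 (pp (HH_add V)).2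
      (pp (UU_add hu.periodic)).1 (pp (UU_add hu.periodic)).2 hCH hM0 hg hspos (by linarith) hCφ0 hCφ hτ
      (by positivity : 0 < (ε ^ 2)⁻¹) (fun q hq => lap_sol hu hq) isClosed_closedBall.measurableSet
      (hQT.trans hTL) (fun q hq => by have := hT0 q (hQT hq); linarith) c hM
  have key := local_osc ho hU hρ (hQT.trans hsub) hA hE hzp
  unfold UU at key
  rw [eL_surj, eL_surj] at key
  exact key

/-- **Lemma 3.3.** Let `u_ε` be a sequence of solutions of `(E_ε)` and
`K ⊆ Ω ∖ Z` compact. Then there are `a, b > 0` such that for all `r > 0`, whenever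
`z_ε ∈ B_{εr}(x_ε) ⊆ K`, one has `|u_ε(x_ε) − u_ε(z_ε)| ≤ a r² + b`. -/
theorem oscillation_bound
    (V : VortexData) (τ : ℝ) (hτ : 0 < τ)
    (ε : ℕ → ℝ) (hε : ∀ n, 0 < ε n) (hε0 : Tendsto ε atTop (nhds 0))
    (u : ℕ → Pl → ℝ) (hu : ∀ n, IsSolution V τ (ε n) (u n))
    (K : Set Pl) (hK : IsCompact K) (hKZ : K ⊆ (V.Z)ᶜ) :
    ∃ a > 0, ∃ b > 0, ∀ r > 0, ∀ n : ℕ, ∀ x z : Pl,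
      ball x (ε n * r) ⊆ K → z ∈ ball x (ε n * r) →
        |u n x - u n z| ≤ a * r ^ 2 + b := by
  obtain ⟨δ, hδ, b0, hb0, hloc⟩ := local_final V hτ hK hKZ
  obtain ⟨C, hC⟩ := Metric.isBounded_iff.1 hK.isBounded
  set N : ℕ := ⌈C / δ⌉₊ + 1 with hN
  have hN1 : (1 : ℝ) ≤ N := by rw [hN]; push_cast; linarith [Nat.cast_nonneg (α := ℝ) ⌈C / δ⌉₊]
  have hNpos : (0 : ℝ) < N := by linarith
  have hCN : C ≤ N * δ := by
    have h1 := Nat.le_ceil (C / δ)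
    rw [div_le_iff₀ hδ] at h1
    rw [hN]; push_cast; nlinarith
  have hCτ := Cτ_pos hτ
  refine ⟨N * (4 * Cτ τ), by positivity, N * b0 + 1, by positivity, ?_⟩
  intro r hr n x z hball hz
  have hεn := hε n
  have hR : 0 < ε n * r := by positivity
  have hxK : x ∈ K := hball (mem_ball_self hR)
  have hzK : z ∈ K := hball hz
  by_cases hxz : z = x
  · rw [hxz, sub_self, abs_zero]; positivity
  set d := dist z x with hd
  have hdpos : 0 < d := dist_pos.2 hxz
  have hdlt : d < ε n * r := hz
  set ρ := d / N with hρ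
  have hρpos : 0 < ρ := by positivity
  have hρδ : ρ ≤ δ := by
    rw [hρ, div_le_iff₀ hNpos]
    have := hC hzK hxK
    linarith
  have hρd : ρ ≤ ε n * r := by
    have : ρ ≤ d := div_le_self hdpos.le hN1
    linarith
  set S := 4 * Cτ τ * r ^ 2 + b0 with hS
  have hstep : ∀ y ∈ K, ∀ w, dist w y ≤ ρ → |u n y - u n w| ≤ S := by
    intro y hy w hw
    refine (hloc (ε n) (u n) hεn (hu n) y hy w ρ hρpos hρδ hw).trans ?_
    have h1 : ρ ^ 2 ≤ (ε n * r) ^ 2 := by gcongr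
    have h2 : 4 * ((ε n ^ 2)⁻¹ * Cτ τ) * ρ ^ 2 ≤ 4 * ((ε n ^ 2)⁻¹ * Cτ τ) * (ε n * r) ^ 2 := by gcongr
    have h3 : 4 * ((ε n ^ 2)⁻¹ * Cτ τ) * (ε n * r) ^ 2 = 4 * Cτ τ * r ^ 2 := by field_simp
    linarith
  have hch : ∀ i : ℕ, i ≤ N → |u n x - u n (x + ((i : ℝ) / N) • (z - x))| ≤ i * S := by
    intro i
    induction i with
    | zero => intro _; simp
    | succ i ih =>
      intro hi
      have h1 := ih (by omega)
      have hiN : (i : ℝ) ≤ N := by exact_mod_cast (by omega : i ≤ N)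
      have hy : x + ((i : ℝ) / N) • (z - x) ∈ K := by
        apply hball
        rw [mem_ball, dist_eq_norm, add_sub_cancel_left, norm_smul, ← dist_eq_norm, Real.norm_eq_abs,
          abs_of_nonneg (by positivity)]
        have : (i : ℝ) / N ≤ 1 := (div_le_one hNpos).2 hiN
        calc (i : ℝ) / N * dist z x ≤ 1 * d := by gcongr
          _ < _ := by linarith
      have h2 := hstep _ hy (x + (((i + 1 : ℕ) : ℝ) / N) • (z - x)) (by
        rw [dist_eq_norm, add_sub_add_left_eq_sub, ← sub_smul, norm_smul, ← dist_eq_norm z x, Real.norm_eq_abs]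
        have : ((i + 1 : ℕ) : ℝ) / N - (i : ℝ) / N = 1 / N := by push_cast; ring
        rw [this, abs_of_pos (by positivity), hρ]
        apply le_of_eq; ring)
      have h3 := abs_sub_le (u n x) (u n (x + ((i : ℝ) / N) • (z - x))) (u n (x + (((i + 1 : ℕ) : ℝ) / N) • (z - x)))
      have e : ((i + 1 : ℕ) : ℝ) * S = i * S + S := by push_cast; ring
      rw [e]
      linarith
  have hfin := hch N le_rfl
  rw [div_self hNpos.ne', one_smul, add_sub_cancel] at hfin
  rw [hS] at hfin
  linarith
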